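/- arXiv:2102.00113 — 6 statements merged into one kernel-verified Lean document; each statement's English description precedes it below -/
import Mathlib

section
/- Let α ∈ (0, 2) and let u : ℝ → ℝ be given by u(x) = (1 + x²)^{-1}. Then for every x ∈ ℝ the principal value limit defining the fractional Laplacian of u at x exists, and C_{1,α} · lim_{ε→0⁺} ∫_{{y : |x−y| > ε}} (u(x) − u(y)) / |x − y|^{1+α} dy = Γ(1+α) · cos((1+α)·arctan|x|) · (1 + x²)^{-(1+α)/2}. -/
open MeasureTheory Real Topology Filter

/-- The normalization constant `C_{d,α} = 2^{α-1} α Γ((α+d)/2) / (π^{d/2} Γ(1-α/2))`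
of the fractional Laplacian. -/
noncomputable def fracLapConst (d : ℕ) (α : ℝ) : ℝ :=
  2 ^ (α - 1) * α * Real.Gamma ((α + d) / 2) /
    (Real.pi ^ ((d : ℝ) / 2) * Real.Gamma (1 - α / 2))



lemma aux_int (s : ℝ) (hs : 0 < s) (b : ℝ) (hb : 0 < b) :
    IntegrableOn (fun t : ℝ => t ^ (s - 1) * rexp (-(b * t))) (Set.Ioi 0) := by
  have := integrableOn_rpow_mul_exp_neg_mul_rpow (p := 1) (s := s - 1) (b := b) (by linarith) one_pos hb
  simpa using this

lemma aux_meas (s : ℝ) (r : ℂ) : Measurable (fun t : ℝ => ((t ^ (s - 1) : ℝ) : ℂ) * Complex.exp (-(r * t))) := by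
  fun_prop

lemma aux_norm (s : ℝ) (r : ℂ) (t : ℝ) (ht : 0 < t) :
    ‖((t ^ (s - 1) : ℝ) : ℂ) * Complex.exp (-(r * t))‖ = t ^ (s - 1) * rexp (-(r.re * t)) := by
  rw [norm_mul, Complex.norm_exp, Complex.norm_real, Real.norm_of_nonneg (by positivity)]
  simp

lemma aux_intC (s : ℝ) (hs : 0 < s) (r : ℂ) (hr : 0 < r.re) :
    IntegrableOn (fun t : ℝ => ((t ^ (s - 1) : ℝ) : ℂ) * Complex.exp (-(r * t))) (Set.Ioi 0) := by
  refine (aux_int s hs r.re hr).mono' (aux_meas s r).aestronglyMeasurable ?_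
  filter_upwards [ae_restrict_mem measurableSet_Ioi] with t ht
  exact (aux_norm s r t ht).le

lemma aux_diff (s : ℝ) (hs : 0 < s) (r : ℂ) (hr : 0 < r.re) :
    DifferentiableAt ℂ (fun r : ℂ => ∫ t in Set.Ioi (0:ℝ), ((t ^ (s - 1) : ℝ) : ℂ) * Complex.exp (-(r * t))) r := by
  have hopen : {z : ℂ | r.re / 2 < z.re} ∈ 𝓝 r :=
    (isOpen_lt continuous_const Complex.continuous_re).mem_nhds (by simp; linarith)
  have := hasDerivAt_integral_of_dominated_loc_of_deriv_le (𝕜 := ℂ) (μ := volume.restrict (Set.Ioi (0:ℝ)))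
    (F := fun (r : ℂ) (t : ℝ) => ((t ^ (s - 1) : ℝ) : ℂ) * Complex.exp (-(r * t)))
    (F' := fun (r : ℂ) (t : ℝ) => ((t ^ (s - 1) : ℝ) : ℂ) * (Complex.exp (-(r * t)) * (-t)))
    (bound := fun t => t ^ ((s+1) - 1) * rexp (-(r.re / 2 * t)))
    (x₀ := r) hopen (Eventually.of_forall fun z => (aux_meas s z).aestronglyMeasurable)
    (aux_intC s hs r hr) (by apply Measurable.aestronglyMeasurable; fun_prop) ?_
    (aux_int (s+1) (by linarith) _ (by linarith)) ?_
  · exact this.2.differentiableAt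
  · filter_upwards [ae_restrict_mem measurableSet_Ioi] with t ht z hz
    have ht' : (0:ℝ) < t := ht
    rw [← mul_assoc, norm_mul, aux_norm s z t ht]
    have : t ^ (s + 1 - 1) = t ^ (s - 1) * t := by
      rw [← Real.rpow_add_one ht'.ne']; ring_nf
    rw [this, norm_neg, Complex.norm_real, Real.norm_of_nonneg ht'.le, mul_right_comm]
    have hz' : r.re / 2 < z.re := hz
    gcongr
  · refine Eventually.of_forall fun t z _ => ?_
    have h1 : HasDerivAt (fun z : ℂ => -(z * t)) (-(t:ℂ)) z := by
      simpa using! ((hasDerivAt_id z).mul_const (t:ℂ)).neg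
    exact (h1.cexp).const_mul _

lemma gammaC (s : ℝ) (hs : 0 < s) (r : ℂ) (hr : 0 < r.re) :
    ∫ t in Set.Ioi (0:ℝ), ((t ^ (s - 1) : ℝ) : ℂ) * Complex.exp (-(r * t)) =
      (1 / r) ^ (s : ℂ) * (Real.Gamma s : ℂ) := by
  have hU : IsOpen {z : ℂ | 0 < z.re} := isOpen_lt continuous_const Complex.continuous_re
  have hf : AnalyticOnNhd ℂ (fun r : ℂ => ∫ t in Set.Ioi (0:ℝ), ((t ^ (s - 1) : ℝ) : ℂ) * Complex.exp (-(r * t))) {z : ℂ | 0 < z.re} :=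
    DifferentiableOn.analyticOnNhd (fun z hz => (aux_diff s hs z hz).differentiableWithinAt) hU
  have hg : AnalyticOnNhd ℂ (fun r : ℂ => (1 / r) ^ (s : ℂ) * (Real.Gamma s : ℂ)) {z : ℂ | 0 < z.re} := by
    refine DifferentiableOn.analyticOnNhd (fun z hz => ?_) hU
    have hz' : 0 < z.re := hz
    have hz0 : z ≠ 0 := by rintro rfl; simp at hz'
    have : 1 / z ∈ Complex.slitPlane := by
      left
      rw [one_div, Complex.inv_re]
      exact div_pos hz' (Complex.normSq_pos.2 hz0)
    apply DifferentiableAt.differentiableWithinAt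
    apply DifferentiableAt.mul_const
    exact DifferentiableAt.cpow_const (by fun_prop (disch := assumption)) this
  have hpc : IsPreconnected {z : ℂ | 0 < z.re} := (convex_halfSpace_re_gt 0).isPreconnected
  refine hf.eqOn_of_preconnected_of_frequently_eq hg hpc (z₀ := 1) (by simp) ?_ hr
  have ht : Tendsto (fun n : ℕ => (((1 + 1 / ((n:ℝ) + 1) : ℝ)) : ℂ)) atTop (𝓝[≠] 1) := by
    refine tendsto_nhdsWithin_iff.2 ⟨?_, Eventually.of_forall fun n => ?_⟩
    · have h1 : Tendsto (fun n : ℕ => (1 + 1 / ((n:ℝ) + 1) : ℝ)) atTop (𝓝 (1 + 0)) :=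
        tendsto_const_nhds.add tendsto_one_div_add_atTop_nhds_zero_nat
      rw [add_zero] at h1
      have h2 := (Complex.continuous_ofReal.tendsto 1).comp h1
      rw [Complex.ofReal_one] at h2
      exact h2
    · simp only [Set.mem_compl_iff, Set.mem_singleton_iff]
      norm_cast
      have : (0:ℝ) < 1 / ((n:ℝ) + 1) := by positivity
      intro h
      push_cast at h
      linarith
  refine ht.frequently (Eventually.of_forall fun n => ?_).frequently
  set q : ℝ := 1 + 1 / ((n:ℝ) + 1) with hq
  have hq0 : 0 < q := by positivity
  have := Real.integral_rpow_mul_exp_neg_mul_Ioi hs hq0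
  have h2 := congrArg (fun x : ℝ => (x : ℂ)) this
  rw [← integral_complex_ofReal] at h2
  rw [Complex.ofReal_mul, Complex.ofReal_cpow (by positivity)] at h2
  simpa using h2

lemma cpow_re (s x : ℝ) : ((1 / (1 - x * Complex.I)) ^ (s : ℂ)).re
    = cos (s * arctan x) * (1 + x ^ 2) ^ (-s / 2) := by
  have hpos : 0 < 1 + x ^ 2 := by positivity
  have h1 : 1 / (1 - x * Complex.I) = Complex.exp (((-(Real.log (1 + x ^ 2)) / 2 : ℝ) : ℂ) + (arctan x : ℂ) * Complex.I) := by
    have hsq : rexp (-(Real.log (1 + x ^ 2)) / 2) = (√(1 + x^2))⁻¹ := by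
      rw [Real.sqrt_eq_rpow, ← Real.rpow_neg hpos.le, Real.rpow_def_of_pos hpos]
      ring_nf
    have hs : √(1+x^2) * √(1+x^2) = 1 + x^2 := Real.mul_self_sqrt hpos.le
    have hs0 : √(1+x^2) ≠ 0 := by positivity
    have hne : (1 - x * Complex.I) ≠ 0 := by
      intro h; have := congrArg Complex.re h; simp at this
    rw [Complex.exp_add_mul_I, ← Complex.ofReal_exp, ← Complex.ofReal_cos, ← Complex.ofReal_sin, hsq,
      Real.cos_arctan, Real.sin_arctan, div_eq_iff hne]
    apply Complex.ext
    · simp; field_simp; nlinarith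
    · simp; field_simp; ring
  have hne : (1 / (1 - x * Complex.I)) ≠ 0 := by rw [h1]; exact Complex.exp_ne_zero _
  have ha := neg_pi_div_two_lt_arctan x
  have hb := arctan_lt_pi_div_two x
  rw [Complex.cpow_def_of_ne_zero hne, h1]
  clear h1 hne
  generalize arctan x = θ at *
  rw [Complex.log_exp]
  · rw [Complex.exp_re, Real.rpow_def_of_pos hpos]
    simp
    rw [mul_comm, mul_comm s]
    congr 2
    ring
  · simp; linarith [pi_pos]
  · simp; linarith [pi_pos]

lemma cos_int (p : ℝ) (hp : 0 ≤ p) (x : ℝ) :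
    IntegrableOn (fun t : ℝ => t ^ p * (rexp (-t) * cos (t * x))) (Set.Ioi 0) ∧ 
    ∫ t in Set.Ioi (0:ℝ), t ^ p * (rexp (-t) * cos (t * x)) = 
    Real.Gamma (1 + p) * cos ((1 + p) * arctan x) * (1 + x ^ 2) ^ (-(1 + p) / 2) := by
  have hr : 0 < (1 - x * Complex.I).re := by simp
  have h1 := aux_intC (1 + p) (by linarith) (1 - x * Complex.I) hr
  have h2 := gammaC (1 + p) (by linarith) (1 - x * Complex.I) hr
  have he : ∀ t : ℝ, (((t ^ (1 + p - 1) : ℝ) : ℂ) * Complex.exp (-((1 - x * Complex.I) * t))).re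
      = t ^ p * (rexp (-t) * cos (t * x)) := by
    intro t
    rw [Complex.re_ofReal_mul, Complex.exp_re]
    simp [mul_comm]
  constructor
  · have := h1.re
    simpa only [RCLike.re_to_complex, he] using! this
  · have := integral_re h1
    simp only [RCLike.re_to_complex, he] at this
    rw [this, h2, Complex.re_mul_ofReal, cpow_re]
    ring

lemma cos_int0 (x : ℝ) :
    IntegrableOn (fun t : ℝ => rexp (-t) * cos (t * x)) (Set.Ioi 0) ∧
    ∫ t in Set.Ioi (0:ℝ), rexp (-t) * cos (t * x) = (1 + x ^ 2)⁻¹ := by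
  have h := cos_int 0 le_rfl x
  simp only [Real.rpow_zero, one_mul, add_zero, Real.Gamma_one] at h
  refine ⟨h.1, h.2.trans ?_⟩
  have hpos : 0 < 1 + x ^ 2 := by positivity
  rw [Real.cos_arctan, Real.sqrt_eq_rpow, one_div, ← Real.rpow_neg hpos.le, ← Real.rpow_add hpos,
    ← Real.rpow_neg_one]
  norm_num

lemma betaInt (α : ℝ) (h0 : 0 < α) (h2 : α < 2) :
    IntegrableOn (fun h : ℝ => h ^ (1 - α) * (1 + h ^ 2)⁻¹) (Set.Ioi 0) ∧
    ∫ h in Set.Ioi (0:ℝ), h ^ (1 - α) * (1 + h ^ 2)⁻¹ =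
      1 / 2 * Real.Gamma (1 - α / 2) * Real.Gamma (α / 2) := by
  have inner1 : ∀ s : ℝ, 0 < s →
      IntegrableOn (fun h : ℝ => rexp (-s) * (h ^ (1 - α) * rexp (-s * h ^ (2:ℝ)))) (Set.Ioi 0) ∧
      ∫ h in Set.Ioi (0:ℝ), rexp (-s) * (h ^ (1 - α) * rexp (-s * h ^ (2:ℝ))) =
        1 / 2 * Real.Gamma (1 - α / 2) * (rexp (-s) * s ^ (α / 2 - 1)) := by
    intro s hs
    constructor
    · exact (integrableOn_rpow_mul_exp_neg_mul_rpow (by linarith) two_pos hs).const_mul _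
    · rw [integral_const_mul, integral_rpow_mul_exp_neg_mul_rpow two_pos (by linarith) hs]
      rw [show (1 - α + 1) / 2 = 1 - α / 2 by ring, show -(1 - α + 1) / 2 = α / 2 - 1 by ring]
      ring
  have inner2 : ∀ h : ℝ,
      ∫ s in Set.Ioi (0:ℝ), rexp (-s) * (h ^ (1 - α) * rexp (-s * h ^ (2:ℝ))) =
        h ^ (1 - α) * (1 + h ^ 2)⁻¹ := by
    intro h
    have hpos : 0 < 1 + h ^ 2 := by positivity
    have := integral_exp_mul_Ioi (a := -(1 + h ^ 2)) (by linarith) 0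
    have e : ∀ s : ℝ, rexp (-s) * (h ^ (1 - α) * rexp (-s * h ^ (2:ℝ)))
        = h ^ (1 - α) * rexp (-(1 + h ^ 2) * s) := by
      intro s
      rw [mul_left_comm, ← Real.exp_add, Real.rpow_two]
      ring_nf
    simp_rw [e]
    rw [integral_const_mul, this]
    rw [mul_zero, Real.exp_zero, neg_div_neg_eq, one_div]
  have hint : Integrable (Function.uncurry fun h s : ℝ => rexp (-s) * (h ^ (1 - α) * rexp (-s * h ^ (2:ℝ))))
      ((volume.restrict (Set.Ioi (0:ℝ))).prod (volume.restrict (Set.Ioi (0:ℝ)))) := by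
    rw [integrable_prod_iff']
    · constructor
      · filter_upwards [ae_restrict_mem measurableSet_Ioi] with s hs
        exact (inner1 s hs).1
      · have : IntegrableOn (fun s : ℝ => 1 / 2 * Real.Gamma (1 - α / 2) * (rexp (-s) * s ^ (α / 2 - 1))) (Set.Ioi 0) :=
          (Real.GammaIntegral_convergent (s := α / 2) (by linarith)).const_mul _
        refine this.congr_fun (fun s hs => ?_) measurableSet_Ioi
        simp only
        rw [← (inner1 s hs).2]
        refine setIntegral_congr_fun measurableSet_Ioi (fun h hh => ?_)
        have hh' : 0 < h := hh
        simp only [Function.uncurry]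
        rw [Real.norm_of_nonneg (by positivity)]
    · apply Measurable.aestronglyMeasurable
      simp only [Function.uncurry_def]
      fun_prop
  constructor
  · have := hint.integral_prod_left
    simp only [Function.uncurry, inner2] at this
    exact this
  · have := integral_integral_swap hint
    simp only [inner2] at this
    rw [this, setIntegral_congr_fun measurableSet_Ioi (fun s hs => (inner1 s hs).2), integral_const_mul,
      Real.Gamma_eq_integral (s := α / 2) (by linarith)]

lemma inner_one_sub (x h : ℝ) :
    IntegrableOn (fun t : ℝ => rexp (-t) * (cos (t * x) * (1 - cos (t * h)))) (Set.Ioi 0) ∧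
    ∫ t in Set.Ioi (0:ℝ), rexp (-t) * (cos (t * x) * (1 - cos (t * h))) =
      1 / 2 * (2 * (1 + x ^ 2)⁻¹ - (1 + (x + h) ^ 2)⁻¹ - (1 + (x - h) ^ 2)⁻¹) := by
  have e : ∀ t : ℝ, rexp (-t) * (cos (t * x) * (1 - cos (t * h))) =
      1 / 2 * (2 * (rexp (-t) * cos (t * x)) - rexp (-t) * cos (t * (x + h))
        - rexp (-t) * cos (t * (x - h))) := by
    intro t
    rw [mul_add t, mul_sub t, cos_add, cos_sub]
    ring
  simp_rw [e]
  obtain ⟨i1, v1⟩ := cos_int0 x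
  obtain ⟨i2, v2⟩ := cos_int0 (x + h)
  obtain ⟨i3, v3⟩ := cos_int0 (x - h)
  have i1' : IntegrableOn (fun t : ℝ => 2 * (rexp (-t) * cos (t * x))) (Set.Ioi 0) := i1.const_mul 2
  have i12 : IntegrableOn (fun t : ℝ => 2 * (rexp (-t) * cos (t * x)) - rexp (-t) * cos (t * (x + h))) (Set.Ioi 0) := i1'.sub i2
  constructor
  · exact (i12.sub i3).const_mul _
  · rw [integral_const_mul, integral_sub i12 i3, integral_sub i1' i2, integral_const_mul, v1, v2, v3]

lemma prodInt (α : ℝ) (h0 : 0 < α) (h2 : α < 2) (x : ℝ) :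
    Integrable (Function.uncurry fun h t : ℝ =>
        rexp (-t) * (cos (t * x) * (1 - cos (t * h))) * h ^ (-(1 + α)))
      ((volume.restrict (Set.Ioi (0:ℝ))).prod (volume.restrict (Set.Ioi (0:ℝ)))) := by
  have key : Integrable (Function.uncurry fun h t : ℝ =>
        rexp (-t) * (cos (t * 0) * (1 - cos (t * h))) * h ^ (-(1 + α)))
      ((volume.restrict (Set.Ioi (0:ℝ))).prod (volume.restrict (Set.Ioi (0:ℝ)))) := by
    rw [integrable_prod_iff]
    · constructor
      · refine Eventually.of_forall fun h => ?_
        exact (inner_one_sub 0 h).1.mul_const (h ^ (-(1 + α)))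
      · refine (betaInt α h0 h2).1.congr_fun (fun h hh => ?_) measurableSet_Ioi
        have hh' : 0 < h := hh
        have : ∀ t : ℝ, ‖Function.uncurry (fun h t : ℝ =>
            rexp (-t) * (cos (t * 0) * (1 - cos (t * h))) * h ^ (-(1 + α))) (h, t)‖
            = rexp (-t) * (cos (t * 0) * (1 - cos (t * h))) * h ^ (-(1 + α)) := by
          intro t
          simp only [Function.uncurry]
          rw [Real.norm_of_nonneg]
          have : 0 ≤ 1 - cos (t * h) := by linarith [cos_le_one (t * h)]
          simp only [mul_zero, cos_zero, one_mul]
          positivity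
        simp_rw [this]
        rw [integral_mul_const, (inner_one_sub 0 h).2]
        rw [show 1 - α = 2 + (-(1 + α)) by ring, Real.rpow_add hh', Real.rpow_two]
        have hpos : (1 + h ^ 2) ≠ 0 := by positivity
        simp
        field_simp
        ring
    · apply Measurable.aestronglyMeasurable
      simp only [Function.uncurry_def]
      fun_prop
  refine key.norm.mono' ?_ ?_
  · apply Measurable.aestronglyMeasurable
    simp only [Function.uncurry_def]
    fun_prop
  · refine Eventually.of_forall fun p => ?_
    simp only [Function.uncurry, norm_mul, mul_zero, cos_zero, norm_one]
    gcongr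
    exact abs_cos_le_one _

lemma gInt (α : ℝ) (h0 : 0 < α) (h2 : α < 2) (x : ℝ) :
    IntegrableOn (fun h : ℝ => (2 * (1 + x ^ 2)⁻¹ - (1 + (x + h) ^ 2)⁻¹ - (1 + (x - h) ^ 2)⁻¹) * h ^ (-(1 + α))) (Set.Ioi 0) ∧
    ∫ h in Set.Ioi (0:ℝ), (2 * (1 + x ^ 2)⁻¹ - (1 + (x + h) ^ 2)⁻¹ - (1 + (x - h) ^ 2)⁻¹) * h ^ (-(1 + α)) =
     2 * (∫ h in Set.Ioi (0:ℝ), (1 - cos h) * h ^ (-(1 + α))) *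
      (Real.Gamma (1 + α) * cos ((1 + α) * arctan x) * (1 + x ^ 2) ^ (-(1 + α) / 2)) := by
  have hp := prodInt α h0 h2 x
  have e1 : ∀ h : ℝ, ∫ t in Set.Ioi (0:ℝ), rexp (-t) * (cos (t * x) * (1 - cos (t * h))) * h ^ (-(1 + α))
      = 1 / 2 * ((2 * (1 + x ^ 2)⁻¹ - (1 + (x + h) ^ 2)⁻¹ - (1 + (x - h) ^ 2)⁻¹) * h ^ (-(1 + α))) := by
    intro h
    rw [integral_mul_const, (inner_one_sub x h).2]
    ring
  have e2 : ∀ t ∈ Set.Ioi (0:ℝ), ∫ h in Set.Ioi (0:ℝ), rexp (-t) * (cos (t * x) * (1 - cos (t * h))) * h ^ (-(1 + α))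
      = (∫ h in Set.Ioi (0:ℝ), (1 - cos h) * h ^ (-(1 + α))) * (t ^ α * (rexp (-t) * cos (t * x))) := by
    intro t ht
    have ht' : 0 < t := ht
    have hs := integral_comp_mul_left_Ioi (fun h : ℝ => (1 - cos h) * h ^ (-(1 + α))) 0 ht'
    simp only [mul_zero, smul_eq_mul] at hs
    have e : ∀ h ∈ Set.Ioi (0:ℝ), rexp (-t) * (cos (t * x) * (1 - cos (t * h))) * h ^ (-(1 + α))
        = (t ^ (1 + α) * (rexp (-t) * cos (t * x))) * ((1 - cos (t * h)) * (t * h) ^ (-(1 + α))) := by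
      intro h hh
      have hh' : 0 < h := hh
      have : t ^ (1 + α) * t ^ (-(1 + α)) = 1 := by
        rw [← Real.rpow_add ht']; simp
      rw [Real.mul_rpow ht'.le hh'.le]
      linear_combination (-(rexp (-t) * cos (t * x) * (1 - cos (t * h)) * h ^ (-(1 + α)))) * this
    rw [setIntegral_congr_fun measurableSet_Ioi e, integral_const_mul, hs, Real.rpow_add ht', Real.rpow_one]
    field_simp
  constructor
  · have := hp.integral_prod_left
    simp only [Function.uncurry, e1] at this
    have := this.const_mul 2
    refine this.congr (Eventually.of_forall fun h => ?_)
    simp only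
    ring
  · have := integral_integral_swap hp
    simp only [e1] at this
    rw [setIntegral_congr_fun measurableSet_Ioi e2, integral_const_mul, integral_const_mul,
      (cos_int α h0.le x).2] at this
    linear_combination 2 * this

lemma Kval (α : ℝ) (h0 : 0 < α) (h2 : α < 2) :
    2 * (∫ h in Set.Ioi (0:ℝ), (1 - cos h) * h ^ (-(1 + α))) * Real.Gamma (1 + α)
      = Real.Gamma (1 - α / 2) * Real.Gamma (α / 2) := by
  have h := (gInt α h0 h2 0).2
  have hb := (betaInt α h0 h2).2
  simp only [arctan_zero, mul_zero, cos_zero, mul_one, ne_eq, OfNat.ofNat_ne_zero, not_false_eq_true,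
    zero_pow, add_zero, Real.one_rpow] at h
  rw [← h]
  have e : ∀ h ∈ Set.Ioi (0:ℝ), (2 * (1:ℝ)⁻¹ - (1 + (0 + h) ^ 2)⁻¹ - (1 + (0 - h) ^ 2)⁻¹) * h ^ (-(1 + α))
      = 2 * (h ^ (1 - α) * (1 + h ^ 2)⁻¹) := by
    intro h hh
    have hh' : 0 < h := hh
    rw [show 1 - α = 2 + (-(1 + α)) by ring, Real.rpow_add hh', Real.rpow_two]
    have hpos : (1 + h ^ 2) ≠ 0 := by positivity
    simp
    field_simp
    ring
  rw [setIntegral_congr_fun measurableSet_Ioi e, integral_const_mul, hb]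
  ring

lemma constVal (α : ℝ) (h0 : 0 < α) (h2 : α < 2) :
    fracLapConst 1 α * (2 * (∫ h in Set.Ioi (0:ℝ), (1 - cos h) * h ^ (-(1 + α)))) = 1 := by
  have hK := Kval α h0 h2
  set K := ∫ h in Set.Ioi (0:ℝ), (1 - cos h) * h ^ (-(1 + α))
  have hd := Real.Gamma_mul_Gamma_add_half (α / 2)
  have hG : 0 < Real.Gamma α := Real.Gamma_pos_of_pos h0
  have hG1 : 0 < Real.Gamma (1 - α / 2) := Real.Gamma_pos_of_pos (by linarith)
  have hrec : Real.Gamma (1 + α) = α * Real.Gamma α := by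
    rw [add_comm, Real.Gamma_add_one h0.ne']
  have hp : (2:ℝ) ^ (α - 1) * 2 ^ (1 - α) = 1 := by
    rw [← Real.rpow_add two_pos]; simp
  rw [show 2 * (α / 2) = α by ring, show α / 2 + 1 / 2 = (α + 1) / 2 by ring] at hd
  have hpi : 0 < √π := by positivity
  rw [hrec] at hK
  unfold fracLapConst
  rw [Nat.cast_one, ← Real.sqrt_eq_rpow, div_mul_eq_mul_div, div_eq_one_iff_eq (by positivity)]
  apply mul_right_cancel₀ hG.ne'
  linear_combination (2:ℝ) ^ (α - 1) * Real.Gamma ((α + 1) / 2) * hK +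
    (2:ℝ) ^ (α - 1) * Real.Gamma (1 - α / 2) * hd + Real.Gamma (1 - α / 2) * Real.Gamma α * √π * hp

lemma splitInt (α : ℝ) (h0 : 0 < α) (x ε : ℝ) (hε : 0 < ε) :
    ∫ y in {y : ℝ | ε < |x - y|}, ((1 + x ^ 2)⁻¹ - (1 + y ^ 2)⁻¹) / |x - y| ^ (1 + α) =
    ∫ h in Set.Ioi ε, (2 * (1 + x ^ 2)⁻¹ - (1 + (x + h) ^ 2)⁻¹ - (1 + (x - h) ^ 2)⁻¹) * h ^ (-(1 + α)) := by
  set f : ℝ → ℝ := fun y => ((1 + x ^ 2)⁻¹ - (1 + y ^ 2)⁻¹) / |x - y| ^ (1 + α) with hf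
  have hset : {y : ℝ | ε < |x - y|} = Set.Iio (x - ε) ∪ Set.Ioi (x + ε) := by
    ext y
    simp only [Set.mem_ofPred_eq, Set.mem_union, Set.mem_Iio, Set.mem_Ioi, lt_abs]
    constructor
    · rintro (h | h)
      · left; linarith
      · right; linarith
    · rintro (h | h)
      · left; linarith
      · right; linarith
  have mp1 : MeasurePreserving (fun h : ℝ => x + h) volume volume := measurePreserving_add_left volume x
  have me1 : MeasurableEmbedding (fun h : ℝ => x + h) := (MeasurableEquiv.addLeft x).measurableEmbedding
  have mp2 : MeasurePreserving (fun h : ℝ => x - h) volume volume := Measure.measurePreserving_sub_left volume x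
  have me2 : MeasurableEmbedding (fun h : ℝ => x - h) := (MeasurableEquiv.subLeft x).measurableEmbedding
  have p1 : (fun h : ℝ => x + h) ⁻¹' Set.Ioi (x + ε) = Set.Ioi ε := by ext; simp
  have p2 : (fun h : ℝ => x - h) ⁻¹' Set.Iio (x - ε) = Set.Ioi ε := by ext; simp
  have v1 : ∀ h ∈ Set.Ioi ε, f (x + h) = ((1 + x ^ 2)⁻¹ - (1 + (x + h) ^ 2)⁻¹) * h ^ (-(1 + α)) := by
    intro h hh
    have hh' : 0 < h := hε.trans hh
    simp only [hf]
    rw [show x - (x + h) = -h by ring, abs_neg, abs_of_pos hh', Real.rpow_neg hh'.le, div_eq_mul_inv]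
  have v2 : ∀ h ∈ Set.Ioi ε, f (x - h) = ((1 + x ^ 2)⁻¹ - (1 + (x - h) ^ 2)⁻¹) * h ^ (-(1 + α)) := by
    intro h hh
    have hh' : 0 < h := hε.trans hh
    simp only [hf]
    rw [show x - (x - h) = h by ring, abs_of_pos hh', Real.rpow_neg hh'.le, div_eq_mul_inv]
  have hbase : IntegrableOn (fun h : ℝ => h ^ (-(1 + α))) (Set.Ioi ε) :=
    integrableOn_Ioi_rpow_of_lt (by linarith) hε
  have hb : ∀ z : ℝ, |(1 + x ^ 2)⁻¹ - (1 + z ^ 2)⁻¹| ≤ 1 := by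
    intro z
    have a1 : 0 ≤ (1 + x ^ 2)⁻¹ := by positivity
    have a2 : 0 ≤ (1 + z ^ 2)⁻¹ := by positivity
    have a3 : (1 + x ^ 2)⁻¹ ≤ 1 := inv_le_one_of_one_le₀ (by nlinarith [sq_nonneg x])
    have a4 : (1 + z ^ 2)⁻¹ ≤ 1 := inv_le_one_of_one_le₀ (by nlinarith [sq_nonneg z])
    rw [abs_le]; constructor <;> linarith
  have hi : ∀ g : ℝ → ℝ, Measurable g → IntegrableOn (fun h : ℝ => ((1 + x ^ 2)⁻¹ - (1 + (g h) ^ 2)⁻¹) * h ^ (-(1 + α))) (Set.Ioi ε) := by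
    intro g hg
    refine hbase.bdd_mul (c := 1) ?_ (Eventually.of_forall fun h => hb (g h))
    apply Measurable.aestronglyMeasurable
    fun_prop
  have i1 := hi (fun h => x + h) (by fun_prop)
  have i2 := hi (fun h => x - h) (by fun_prop)
  have j1 : IntegrableOn f (Set.Ioi (x + ε)) := by
    rw [← mp1.integrableOn_comp_preimage me1, p1]
    exact i1.congr_fun (fun h hh => (v1 h hh).symm) measurableSet_Ioi
  have j2 : IntegrableOn f (Set.Iio (x - ε)) := by
    rw [← mp2.integrableOn_comp_preimage me2, p2]
    exact i2.congr_fun (fun h hh => (v2 h hh).symm) measurableSet_Ioi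
  have hdisj : Disjoint (Set.Iio (x - ε)) (Set.Ioi (x + ε)) := by
    rw [Set.disjoint_left]
    intro y hy hy'
    simp only [Set.mem_Iio, Set.mem_Ioi] at hy hy'
    linarith
  rw [hset, setIntegral_union hdisj measurableSet_Ioi j2 j1,
    ← mp1.setIntegral_preimage_emb me1 f (Set.Ioi (x + ε)), ← mp2.setIntegral_preimage_emb me2 f (Set.Iio (x - ε)), p1, p2,
    setIntegral_congr_fun measurableSet_Ioi v1, setIntegral_congr_fun measurableSet_Ioi v2,
    ← integral_add i2 i1]
  congr 1
  ext h
  ring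

/-- For `α ∈ (0,2)` and `u(x) = (1+x²)^{-1}` on `ℝ`, the principal value limit
defining the fractional Laplacian of `u` at every `x ∈ ℝ` exists and equals
`Γ(1+α) cos((1+α) arctan|x|) (1+x²)^{-(1+α)/2}`. -/
theorem fracLap_inverseQuadric_1d (α : ℝ) (hα : α ∈ Set.Ioo (0 : ℝ) 2)
    (u : ℝ → ℝ) (hu : ∀ x, u x = (1 + x ^ 2)⁻¹) (x : ℝ) :
    Tendsto
      (fun ε : ℝ => fracLapConst 1 α *
        ∫ y in {y : ℝ | ε < |x - y|}, (u x - u y) / |x - y| ^ (1 + α))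
      (𝓝[>] 0)
      (𝓝 (Real.Gamma (1 + α) * Real.cos ((1 + α) * Real.arctan |x|) *
        (1 + x ^ 2) ^ (-(1 + α) / 2))) := by
  obtain ⟨h0, h2⟩ := hα
  obtain ⟨gi, gv⟩ := gInt α h0 h2 x
  have hc := constVal α h0 h2
  have habs : cos ((1 + α) * arctan |x|) = cos ((1 + α) * arctan x) := by
    rcases abs_choice x with h | h
    · rw [h]
    · rw [h, arctan_neg, mul_neg, cos_neg]
  have hlim : fracLapConst 1 α * ∫ h in Set.Ioi (0:ℝ), (2 * (1 + x ^ 2)⁻¹ - (1 + (x + h) ^ 2)⁻¹ - (1 + (x - h) ^ 2)⁻¹) * h ^ (-(1 + α)) =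
      Real.Gamma (1 + α) * Real.cos ((1 + α) * Real.arctan |x|) * (1 + x ^ 2) ^ (-(1 + α) / 2) := by
    rw [gv, habs, ← mul_assoc, hc, one_mul]
  rw [← hlim]
  refine Tendsto.const_mul _ ?_
  simp only [hu]
  have hcov : AECover (volume.restrict (Set.Ioi (0:ℝ))) (𝓝[>] (0:ℝ)) (fun ε : ℝ => Set.Ioi ε) := by
    refine ⟨?_, fun _ => measurableSet_Ioi⟩
    filter_upwards [ae_restrict_mem measurableSet_Ioi] with h hh
    exact mem_nhdsWithin_of_mem_nhds (Iio_mem_nhds hh)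
  refine (hcov.integral_tendsto_of_countably_generated gi).congr' ?_
  filter_upwards [self_mem_nhdsWithin] with ε hε
  have hε' : 0 < ε := hε
  rw [splitInt α h0 x ε hε', Measure.restrict_restrict measurableSet_Ioi,
    Set.inter_eq_left.2 (Set.Ioi_subset_Ioi hε'.le)]
end

section
/- For every real α ≥ 0 and every x ∈ ℝ, the Fourier-multiplier representation of (-Δ)^{α/2} applied to u(x) = (1 + x²)^{-1} evaluates in closed form: ∫_ℝ (2π|ξ|)^α · π e^{-2π|ξ|} · e^{2πi x ξ} dξ = Γ(1+α) · cos((1+α)·arctan|x|) · (1 + x²)^{-(1+α)/2}. -/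
open MeasureTheory Real

lemma aux_int_s3 (α : ℝ) (hα : 0 ≤ α) (z : ℝ) (hz : z < 0) :
    IntegrableOn (fun t : ℝ => t ^ α * Real.exp (z * t)) (Set.Ioi 0) := by
  have h := Real.integral_rpow_mul_exp_neg_mul_Ioi (a := α + 1) (r := -z) (by linarith) (by linarith)
  have h2 : IntegrableOn (fun t : ℝ => t ^ (α + 1 - 1) * Real.exp (-(-z * t))) (Set.Ioi 0) := by
    apply Integrable.of_integral_ne_zero
    rw [h]
    have := Real.Gamma_pos_of_pos (s := α + 1) (by linarith)
    have h3 : 0 < 1 / -z := one_div_pos.2 (by linarith)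
    positivity
  simpa using h2

noncomputable def auxM (α : ℝ) : Measure ℝ :=
  (volume.restrict (Set.Ioi 0)).withDensity (fun t => ENNReal.ofReal (t ^ α))

lemma aux_mgf (α : ℝ) (z : ℂ) :
    ProbabilityTheory.complexMGF id (auxM α) z =
      ∫ t : ℝ in Set.Ioi 0, ((t ^ α : ℝ) : ℂ) * Complex.exp (z * t) := by
  unfold ProbabilityTheory.complexMGF auxM
  rw [integral_withDensity_eq_integral_toReal_smul (by fun_prop) (by simp)]
  refine setIntegral_congr_fun measurableSet_Ioi (fun t ht => ?_)
  have ht' : (0 : ℝ) < t := ht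
  simp only [id]
  rw [ENNReal.toReal_ofReal (by positivity), Complex.real_smul]

lemma aux_set (α : ℝ) (hα : 0 ≤ α) :
    Set.Iio 0 ⊆ ProbabilityTheory.integrableExpSet id (auxM α) := by
  intro z hz
  change Integrable _ _
  unfold auxM
  rw [integrable_withDensity_iff (by fun_prop) (by simp)]
  refine (aux_int_s3 α hα z hz).congr_fun (fun t ht => ?_) measurableSet_Ioi
  have ht' : (0 : ℝ) < t := ht
  simp only [id]
  rw [ENNReal.toReal_ofReal (by positivity), mul_comm]

lemma aux_key (α : ℝ) (hα : 0 ≤ α) (z : ℂ) (hz : z.re < 0) :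
    ∫ t : ℝ in Set.Ioi 0, ((t ^ α : ℝ) : ℂ) * Complex.exp (z * t) =
      (-z) ^ (-(1 + α : ℂ)) * Complex.Gamma (1 + α) := by
  rw [← aux_mgf]
  have hU : IsOpen {z : ℂ | z.re < 0} := isOpen_lt Complex.continuous_re continuous_const
  have hf : AnalyticOnNhd ℂ (ProbabilityTheory.complexMGF id (auxM α)) {z : ℂ | z.re < 0} :=
    ProbabilityTheory.analyticOnNhd_complexMGF.mono
      (fun z hz => interior_maximal (aux_set α hα) isOpen_Iio hz)
  have hg : AnalyticOnNhd ℂ (fun z : ℂ => (-z) ^ (-(1 + α : ℂ)) * Complex.Gamma (1 + α))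
      {z : ℂ | z.re < 0} := by
    refine DifferentiableOn.analyticOnNhd (fun z hz => ?_) hU
    apply DifferentiableAt.differentiableWithinAt
    refine DifferentiableAt.mul_const ?_ _
    refine DifferentiableAt.cpow (by fun_prop) (by fun_prop) (Or.inl ?_)
    simpa using hz
  refine hf.eqOn_of_preconnected_of_frequently_eq (z₀ := -1) hg
    (convex_halfSpace_re_lt 0).isPreconnected (by simp) ?_ hz
  have hreal : ∀ r : ℝ, r < 0 → ProbabilityTheory.complexMGF id (auxM α) r =
      (-(r : ℂ)) ^ (-(1 + α : ℂ)) * Complex.Gamma (1 + α) := by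
    intro r hr
    rw [aux_mgf]
    have h := Complex.integral_cpow_mul_exp_neg_mul_Ioi (a := (1 + α : ℂ)) (r := -r)
      (by simp; linarith) (by linarith)
    have e : ((1 : ℂ) / ((-r : ℝ) : ℂ)) ^ (1 + α : ℂ) = (-(r : ℂ)) ^ (-(1 + α : ℂ)) := by
      rw [one_div, Complex.inv_cpow, Complex.cpow_neg]
      · simp
      · rw [Complex.arg_ofReal_of_nonneg (by linarith)]
        exact Real.pi_pos.ne
    rw [← e, ← h]
    refine setIntegral_congr_fun measurableSet_Ioi (fun t ht => ?_)
    have ht' : (0 : ℝ) < t := ht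
    rw [Complex.ofReal_cpow ht'.le]
    simp
  have ht : Filter.Tendsto (fun r : ℝ => (r : ℂ)) (nhdsWithin (-1) {-1}ᶜ)
      (nhdsWithin (-1 : ℂ) {-1}ᶜ) := by
    refine tendsto_nhdsWithin_iff.2 ⟨?_, ?_⟩
    · have := (Complex.continuous_ofReal.tendsto (-1 : ℝ))
      simp only [Complex.ofReal_neg, Complex.ofReal_one] at this
      exact this.mono_left nhdsWithin_le_nhds
    · filter_upwards [self_mem_nhdsWithin] with r hr h
      apply hr
      have h' : (r : ℂ) = -1 := h
      exact_mod_cast h'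
  refine ht.frequently (Filter.Eventually.frequently ?_)
  have : Set.Iio (0 : ℝ) ∈ nhds (-1 : ℝ) := Iio_mem_nhds (by norm_num)
  filter_upwards [nhdsWithin_le_nhds this] with r hr
  exact hreal r hr

lemma aux_cpow (α x : ℝ) : (1 - Complex.I * x : ℂ) ^ (-(1 + α : ℂ)) =
    (((1 + x ^ 2) ^ (-(1 + α) / 2) : ℝ) : ℂ) *
      Complex.exp ((((1 + α) * Real.arctan x : ℝ) : ℂ) * Complex.I) := by
  have hp : 0 < 1 + x ^ 2 := by positivity
  have hs : 0 < √(1 + x ^ 2) := Real.sqrt_pos.2 hp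
  have e : (1 - Complex.I * x : ℂ) =
      Complex.exp (((Real.log (1 + x ^ 2) / 2 : ℝ) : ℂ) - Real.arctan x * Complex.I) := by
    rw [sub_eq_add_neg ((_ : ℝ) : ℂ), Complex.exp_add, ← Complex.ofReal_exp, ← Real.log_sqrt hp.le,
      Real.exp_log hs, ← neg_mul, ← Complex.ofReal_neg, Complex.exp_mul_I, ← Complex.ofReal_cos,
      ← Complex.ofReal_sin, Real.cos_neg, Real.sin_neg, Real.sin_arctan, Real.cos_arctan]
    apply Complex.ext
    · simp; field_simp
    · simp; field_simp
  have hl : Complex.log (1 - Complex.I * x : ℂ) =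
      ((Real.log (1 + x ^ 2) / 2 : ℝ) : ℂ) - Real.arctan x * Complex.I := by
    have h1 := Real.arctan_lt_pi_div_two x
    have h2 := Real.neg_pi_div_two_lt_arctan x
    have h3 := Real.pi_pos
    rw [e, Complex.log_exp]
    · simp [-Complex.ofReal_arctan]; linarith
    · simp [-Complex.ofReal_arctan]; linarith
  have hne : (1 - Complex.I * x : ℂ) ≠ 0 := by rw [e]; exact Complex.exp_ne_zero _
  rw [Complex.cpow_def_of_ne_zero hne, hl, Real.rpow_def_of_pos hp, Complex.ofReal_exp,
    ← Complex.exp_add]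
  congr 1
  push_cast
  ring

noncomputable def auxF (α x ξ : ℝ) : ℂ :=
  (((2 * Real.pi * |ξ|) ^ α * (Real.pi * Real.exp (-(2 * Real.pi * |ξ|))) : ℝ) : ℂ) *
        Complex.exp (2 * (Real.pi : ℂ) * Complex.I * (x : ℂ) * (ξ : ℂ))

lemma auxF_neg (α x ξ : ℝ) : auxF α x (-ξ) = auxF α (-x) ξ := by
  unfold auxF
  rw [abs_neg]
  push_cast
  ring_nf

lemma auxF_pos (α x ξ : ℝ) (hξ : 0 < ξ) : auxF α x ξ =
    (Real.pi : ℂ) * (((2 * Real.pi * ξ) ^ α : ℝ) *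
      Complex.exp ((-1 + Complex.I * x) * ((2 * Real.pi * ξ : ℝ) : ℂ))) := by
  unfold auxF
  rw [abs_of_pos hξ]
  have : Complex.exp ((-1 + Complex.I * x) * ((2 * Real.pi * ξ : ℝ) : ℂ)) =
    ((Real.exp (-(2 * Real.pi * ξ)) : ℝ) : ℂ) *
      Complex.exp (2 * (Real.pi : ℂ) * Complex.I * (x : ℂ) * (ξ : ℂ)) := by
    rw [Complex.ofReal_exp, ← Complex.exp_add]
    congr 1
    push_cast
    ring
  rw [this]
  push_cast
  ring

lemma auxF_int (α : ℝ) (hα : 0 ≤ α) (x : ℝ) : IntegrableOn (auxF α x) (Set.Ioi 0) := by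
  have h0 := (aux_int_s3 α hα (-1) (by norm_num))
  have h1 : IntegrableOn (fun ξ : ℝ => (2 * Real.pi * ξ) ^ α * Real.exp (-1 * (2 * Real.pi * ξ)))
      (Set.Ioi 0) := by
    have := (integrableOn_Ioi_comp_mul_left_iff
      (fun t : ℝ => t ^ α * Real.exp (-1 * t)) 0 (a := 2 * Real.pi) (by positivity)).2
      (by simpa using h0)
    exact this
  refine Integrable.mono' (h1.const_mul Real.pi) ?_ ?_
  · apply Measurable.aestronglyMeasurable
    unfold auxF
    fun_prop
  · filter_upwards [self_mem_ae_restrict measurableSet_Ioi] with ξ hξ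
    have hξ' : (0 : ℝ) < ξ := hξ
    rw [auxF_pos α x ξ hξ', norm_mul, norm_mul, Complex.norm_exp, Complex.norm_real,
      Complex.norm_real, Real.norm_of_nonneg Real.pi_pos.le, Real.norm_of_nonneg (by positivity)]
    simp

lemma auxF_val (α : ℝ) (hα : 0 ≤ α) (x : ℝ) : ∫ ξ in Set.Ioi 0, auxF α x ξ =
    1 / 2 * ((1 - Complex.I * x) ^ (-(1 + α : ℂ)) * Complex.Gamma (1 + α)) := by
  rw [setIntegral_congr_fun measurableSet_Ioi (fun ξ hξ => auxF_pos α x ξ hξ), integral_const_mul]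
  have h := integral_comp_mul_left_Ioi (fun t : ℝ => ((t ^ α : ℝ) : ℂ) *
    Complex.exp ((-1 + Complex.I * x) * t)) 0 (b := 2 * Real.pi) (by positivity)
  rw [mul_zero, aux_key α hα _ (by simp)] at h
  rw [h, Complex.real_smul]
  have : (Real.pi : ℂ) ≠ 0 := by exact_mod_cast Real.pi_pos.ne'
  have e : -(-1 + Complex.I * (x : ℂ)) = 1 - Complex.I * x := by ring
  rw [e]
  push_cast
  field_simp

lemma aux_main (α : ℝ) (hα : 0 ≤ α) (x : ℝ) : Integrable (auxF α x) ∧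
    ∫ ξ, auxF α x ξ = ((Real.Gamma (1 + α) * Real.cos ((1 + α) * Real.arctan |x|) *
        (1 + x ^ 2) ^ (-(1 + α) / 2) : ℝ) : ℂ) := by
  have hpos := auxF_int α hα x
  have hneg : IntegrableOn (auxF α x) (Set.Iic 0) := by
    rw [← Measure.map_neg_eq_self (volume : Measure ℝ)]
    let m : MeasurableEmbedding fun x : ℝ => -x := (Homeomorph.neg ℝ).measurableEmbedding
    rw [m.integrableOn_map_iff]
    simp_rw [Function.comp_def, auxF_neg, Set.neg_preimage, Set.neg_Iic, neg_zero]
    exact Iff.mpr integrableOn_Ici_iff_integrableOn_Ioi (auxF_int α hα (-x))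
  have hint : Integrable (auxF α x) := by
    rw [← integrableOn_univ, ← Set.Iic_union_Ioi (a := (0 : ℝ))]
    exact hneg.union hpos
  refine ⟨hint, ?_⟩
  have hI : ∫ ξ in Set.Iic 0, auxF α x ξ = ∫ ξ in Set.Ioi 0, auxF α (-x) ξ := by
    have := integral_comp_neg_Iic 0 (auxF α (-x))
    rw [neg_zero] at this
    rw [← this]
    simp_rw [auxF_neg, neg_neg]
  rw [← intervalIntegral.integral_Iic_add_Ioi hneg hpos, hI, auxF_val α hα, auxF_val α hα,
    aux_cpow, aux_cpow, Real.arctan_neg, neg_sq]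
  have hc : Real.cos ((1 + α) * Real.arctan |x|) = Real.cos ((1 + α) * Real.arctan x) := by
    rcases abs_choice x with h | h <;> rw [h]
    rw [Real.arctan_neg, mul_neg, Real.cos_neg]
  rw [hc, mul_neg]
  have hG : Complex.Gamma (1 + α : ℂ) = ((Real.Gamma (1 + α) : ℝ) : ℂ) := by
    rw [← Complex.Gamma_ofReal]
    push_cast
    rfl
  rw [hG]
  generalize (1 + α) * Real.arctan x = θ
  generalize (1 + x ^ 2) ^ (-(1 + α) / 2) = P
  generalize Real.Gamma (1 + α) = G
  rw [Complex.ofReal_mul, Complex.ofReal_mul, Complex.ofReal_cos, Complex.cos, Complex.ofReal_neg]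
  ring

/-- For every `α ≥ 0` and every `x ∈ ℝ`, the Fourier-multiplier representation
of `(-Δ)^{α/2}` applied to `u(x) = (1+x²)^{-1}` evaluates in closed form:
`∫_ℝ (2π|ξ|)^α · π e^{-2π|ξ|} · e^{2πixξ} dξ = Γ(1+α) cos((1+α) arctan|x|) (1+x²)^{-(1+α)/2}`;
the integral converges absolutely and its value is real. -/
theorem fourier_multiplier_inverseQuadric_1d (α : ℝ) (hα : 0 ≤ α) (x : ℝ) :
    Integrable (fun ξ : ℝ =>
      (((2 * Real.pi * |ξ|) ^ α * (Real.pi * Real.exp (-(2 * Real.pi * |ξ|))) : ℝ) : ℂ) *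
        Complex.exp (2 * (Real.pi : ℂ) * Complex.I * (x : ℂ) * (ξ : ℂ))) ∧
    (∫ ξ : ℝ,
      (((2 * Real.pi * |ξ|) ^ α * (Real.pi * Real.exp (-(2 * Real.pi * |ξ|))) : ℝ) : ℂ) *
        Complex.exp (2 * (Real.pi : ℂ) * Complex.I * (x : ℂ) * (ξ : ℂ))) =
      ((Real.Gamma (1 + α) * Real.cos ((1 + α) * Real.arctan |x|) *
        (1 + x ^ 2) ^ (-(1 + α) / 2) : ℝ) : ℂ) := by
  exact aux_main α hα x
end

section
/- Let α ∈ (0, 2) and let u : ℝ³ → ℝ be given by u(x) = (1 + |x|²)^{-2}. Then for every x ∈ ℝ³ with x ≠ 0 the principal value limit defining the fractional Laplacian of u at x exists, and C_{3,α} · lim_{ε→0⁺} ∫_{{y : |x−y| > ε}} (u(x) − u(y)) / |x − y|^{3+α} dy = Γ(2+α) · (1 + |x|²)^{-(2+α)/2} · sin((2+α)·arctan|x|) / (2|x|). -/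
open MeasureTheory Real Topology Filter

lemma swapH (f : ℝ → ℝ → ℝ) (hm : Measurable (Function.uncurry f)) (G : ℝ → ℝ)
    (A : ∀ x, 0 < x → IntegrableOn (f x) (Set.Ioi 0))
    (B : ∀ x, 0 < x → ∫ y in Set.Ioi 0, |f x y| = G x)
    (hG : IntegrableOn G (Set.Ioi 0)) :
    IntegrableOn (fun y => ∫ x in Set.Ioi 0, f x y) (Set.Ioi 0) ∧
    ∫ y in Set.Ioi 0, ∫ x in Set.Ioi 0, f x y = ∫ x in Set.Ioi 0, ∫ y in Set.Ioi 0, f x y := by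
  have hI : Integrable (Function.uncurry f)
      ((volume.restrict (Set.Ioi (0:ℝ))).prod (volume.restrict (Set.Ioi (0:ℝ)))) := by
    rw [integrable_prod_iff hm.aestronglyMeasurable]
    constructor
    · filter_upwards [ae_restrict_mem measurableSet_Ioi] with x hx
      exact A x hx
    · refine Integrable.congr hG ?_
      filter_upwards [ae_restrict_mem measurableSet_Ioi] with x hx
      rw [← B x hx]
      rfl
  exact ⟨hI.integral_prod_right, (integral_integral_swap hI).symm⟩

lemma int_rpow_exp {a s : ℝ} (ha : 0 < a) (hs : 0 < s) :
    IntegrableOn (fun t : ℝ => t ^ (a - 1) * exp (-(s * t))) (Set.Ioi 0) := by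
  have := integrableOn_rpow_mul_exp_neg_mul_rpow (s := a - 1) (p := 1) (b := s)
    (by linarith) one_pos hs
  simpa using this

lemma int_exp_cos_sin {s : ℝ} (hs : 0 < s) (ρ : ℝ) :
    (IntegrableOn (fun t : ℝ => exp (-(s * t)) * cos (ρ * t)) (Set.Ioi 0) ∧
      ∫ t in Set.Ioi (0:ℝ), exp (-(s * t)) * cos (ρ * t) = s / (s ^ 2 + ρ ^ 2)) ∧
    (IntegrableOn (fun t : ℝ => exp (-(s * t)) * sin (ρ * t)) (Set.Ioi 0) ∧
      ∫ t in Set.Ioi (0:ℝ), exp (-(s * t)) * sin (ρ * t) = ρ / (s ^ 2 + ρ ^ 2)) := by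
  set a : ℂ := ⟨-s, ρ⟩ with ha
  have hre : a.re < 0 := by simp [ha, hs]
  have h1 := integrableOn_exp_mul_complex_Ioi hre 0
  have h2 := integral_exp_mul_complex_Ioi hre 0
  have e1 : ∀ t : ℝ, (Complex.exp (a * t)).re = exp (-(s * t)) * cos (ρ * t) := by
    intro t; simp [Complex.exp_re, ha]
  have e2 : ∀ t : ℝ, (Complex.exp (a * t)).im = exp (-(s * t)) * sin (ρ * t) := by
    intro t; simp [Complex.exp_im, ha]
  have hsq : Complex.normSq a = s ^ 2 + ρ ^ 2 := by simp [Complex.normSq_apply, ha]; ring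
  have r1 : (-Complex.exp (a * (0:ℝ)) / a).re = s / (s ^ 2 + ρ ^ 2) := by
    simp [Complex.div_re, hsq]; simp [ha]
  have r2 : (-Complex.exp (a * (0:ℝ)) / a).im = ρ / (s ^ 2 + ρ ^ 2) := by
    simp [Complex.div_im, hsq]; simp [ha]; ring
  refine ⟨⟨?_, ?_⟩, ?_, ?_⟩
  · simpa only [RCLike.re_to_complex, e1] using! h1.re
  · rw [← r1, ← h2, ← Complex.reCLM_apply, ← Complex.reCLM.integral_comp_comm h1]
    simp only [Complex.reCLM_apply, e1]
  · simpa only [RCLike.im_to_complex, e2] using! h1.im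
  · rw [← r2, ← h2, ← Complex.imCLM_apply, ← Complex.imCLM.integral_comp_comm h1]
    simp only [Complex.imCLM_apply, e2]

lemma beta_int {α : ℝ} (h0 : 0 < α) (h2 : α < 2) :
    IntegrableOn (fun s : ℝ => s ^ (α - 1) / (1 + s ^ 2)) (Set.Ioi 0) ∧
    ∫ s in Set.Ioi (0:ℝ), s ^ (α - 1) / (1 + s ^ 2) = Gamma (α / 2) * Gamma (1 - α / 2) / 2 := by
  have split : ∀ v s : ℝ, s ^ (α - 1) * exp (-(v * (1 + s ^ 2)))
      = exp (-v) * (s ^ (α - 1) * exp (-v * s ^ (2:ℝ))) := by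
    intro v s
    rw [show -(v * (1 + s ^ 2)) = -v + -v * s ^ (2:ℝ) by rw [rpow_two]; ring, exp_add]; ring
  have inn : ∀ v : ℝ, 0 < v → ∫ s in Set.Ioi (0:ℝ), s ^ (α - 1) * exp (-(v * (1 + s ^ 2)))
        = (v ^ ((1 - α / 2) - 1) * exp (-(1 * v))) * (Gamma (α / 2) / 2) := by
    intro v hv
    simp only [split]
    rw [integral_const_mul, integral_rpow_mul_exp_neg_mul_rpow two_pos (by linarith) hv]
    rw [show -(α - 1 + 1) / 2 = (1 - α / 2) - 1 by ring, show (α - 1 + 1) / 2 = α / 2 by ring,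
      one_mul]
    ring
  have key := swapH (fun v s => s ^ (α - 1) * exp (-(v * (1 + s ^ 2))))
    (by unfold Function.uncurry; fun_prop)
    (fun v => (v ^ ((1 - α / 2) - 1) * exp (-(1 * v))) * (Gamma (α / 2) / 2)) ?_ ?_ ?_
  · have hv : ∀ s ∈ Set.Ioi (0:ℝ), ∫ v in Set.Ioi (0:ℝ), s ^ (α - 1) * exp (-(v * (1 + s ^ 2)))
        = s ^ (α - 1) / (1 + s ^ 2) := by
      intro s hs
      rw [integral_const_mul]
      have := (int_exp_cos_sin (s := 1 + s ^ 2) (by positivity) 0).1.2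
      simp only [zero_mul, cos_zero, mul_one] at this
      simp only [mul_comm _ (1 + s ^ 2)]
      rw [this]
      field_simp
      ring
    refine ⟨key.1.congr_fun hv measurableSet_Ioi, ?_⟩
    rw [← setIntegral_congr_fun measurableSet_Ioi hv, key.2]
    rw [setIntegral_congr_fun measurableSet_Ioi (fun v hv => inn v hv), integral_mul_const,
      integral_rpow_mul_exp_neg_mul_Ioi (by linarith) one_pos]
    simp; ring
  · intro v hv
    simp only [split]
    exact (integrableOn_rpow_mul_exp_neg_mul_rpow (by linarith) two_pos hv).const_mul _
  · intro v hv
    rw [← inn v hv]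
    refine setIntegral_congr_fun measurableSet_Ioi (fun s hs => ?_)
    have : (0:ℝ) < s := hs
    exact abs_of_nonneg (by positivity)
  · exact (int_rpow_exp (by linarith) one_pos).mul_const _

lemma J_int {α : ℝ} (h0 : 0 < α) (h2 : α < 2) :
    IntegrableOn (fun t : ℝ => (t - sin t) * t ^ (-(2 + α))) (Set.Ioi 0) ∧
    ∫ t in Set.Ioi (0:ℝ), (t - sin t) * t ^ (-(2 + α)) =
      Gamma (α / 2) * Gamma (1 - α / 2) / 2 / Gamma (2 + α) := by
  have hΓ : 0 < Gamma (2 + α) := Gamma_pos_of_pos (by linarith)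
  obtain ⟨b1, b2⟩ := beta_int h0 h2
  have lap : ∀ s : ℝ, 0 < s → IntegrableOn
      (fun t : ℝ => s ^ (1 + α) * ((t - sin t) * exp (-(s * t)))) (Set.Ioi 0) ∧
      ∫ t in Set.Ioi (0:ℝ), s ^ (1 + α) * ((t - sin t) * exp (-(s * t))) =
        s ^ (α - 1) / (1 + s ^ 2) := by
    intro s hs
    have i1 := int_rpow_exp (a := 2) two_pos hs
    have v1 := integral_rpow_mul_exp_neg_mul_Ioi (a := 2) two_pos hs
    obtain ⟨i2, v2⟩ := (int_exp_cos_sin hs 1).2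
    have e : ∀ t : ℝ, (t - sin t) * exp (-(s * t)) =
      t ^ ((2:ℝ) - 1) * exp (-(s * t)) - exp (-(s * t)) * sin (1 * t) := by
      intro t; rw [show (2:ℝ) - 1 = 1 by norm_num, rpow_one, one_mul]; ring
    simp only [e]
    refine ⟨(i1.sub i2).const_mul _, ?_⟩
    rw [integral_const_mul, integral_sub i1 i2, v1, v2, Gamma_two, rpow_two,
      show 1 + α = (α - 1) + 2 by ring, rpow_add hs, rpow_two]
    field_simp
    ring
  have key := swapH (fun s t => s ^ (1 + α) * ((t - sin t) * exp (-(s * t))))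
    (by unfold Function.uncurry; fun_prop)
    (fun s => s ^ (α - 1) / (1 + s ^ 2)) (fun s hs => (lap s hs).1) ?_ b1
  · have hv : ∀ t ∈ Set.Ioi (0:ℝ), ∫ s in Set.Ioi (0:ℝ),
        s ^ (1 + α) * ((t - sin t) * exp (-(s * t)))
        = ((t - sin t) * t ^ (-(2 + α))) * Gamma (2 + α) := by
      intro t ht
      have ht : 0 < t := ht
      have := integral_rpow_mul_exp_neg_mul_Ioi (a := 2 + α) (by linarith) ht
      rw [show 2 + α - 1 = 1 + α by ring, one_div, inv_rpow ht.le, ← rpow_neg ht.le] at this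
      rw [mul_assoc, ← this, ← integral_const_mul]
      congr 1; ext s; rw [mul_comm t s]; ring
    have k1 := key.1.congr_fun hv measurableSet_Ioi
    have k2 := key.2
    rw [setIntegral_congr_fun measurableSet_Ioi hv,
      setIntegral_congr_fun measurableSet_Ioi (fun s hs => (lap s hs).2), b2,
      integral_mul_const] at k2
    constructor
    · have := k1.mul_const (Gamma (2 + α))⁻¹
      simpa [mul_assoc, hΓ.ne'] using! this
    · rw [← k2]; field_simp
  · intro s hs
    rw [← (lap s hs).2]
    refine setIntegral_congr_fun measurableSet_Ioi (fun t ht => ?_)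
    have ht : (0:ℝ) < t := ht
    have := sin_le ht.le
    exact abs_of_nonneg (mul_nonneg (by positivity) (mul_nonneg (by linarith) (by positivity)))
lemma gammaF {a : ℝ} (ha : 0 < a) (ρ : ℝ) :
    IntegrableOn (fun t : ℝ => ((t ^ (a - 1) : ℝ) : ℂ) * Complex.exp (-((1 - ρ * Complex.I) * t)))
      (Set.Ioi 0) ∧
    (∫ t in Set.Ioi (0:ℝ), ((t ^ (a - 1) : ℝ) : ℂ) * Complex.exp (-((1 - ρ * Complex.I) * t))) *
      Complex.exp (a * Complex.log (1 - ρ * Complex.I)) = Gamma a := by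
  have hnorm : ∀ b ρ t : ℝ, 0 < t →
      ‖((t ^ b : ℝ) : ℂ) * Complex.exp (-((1 - ρ * Complex.I) * t))‖ = t ^ b * exp (-(1 * t)) := by
    intro b ρ t ht
    rw [norm_mul, Complex.norm_exp, Complex.norm_real, norm_of_nonneg (by positivity)]
    simp
  have hInt : ∀ (a : ℝ), 0 < a → ∀ (ρ : ℝ), IntegrableOn (fun t : ℝ => ((t ^ (a - 1) : ℝ) : ℂ) *
      Complex.exp (-((1 - ρ * Complex.I) * t))) (Set.Ioi 0) := by
    intro a ha ρ
    refine Integrable.mono' (int_rpow_exp ha one_pos) ?_ ?_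
    · exact Measurable.aestronglyMeasurable (by fun_prop)
    · filter_upwards [ae_restrict_mem measurableSet_Ioi] with t ht
      exact (hnorm _ _ _ ht).le
  refine ⟨hInt a ha ρ, ?_⟩
  set F : ℝ → ℂ := fun ρ => ∫ t in Set.Ioi (0:ℝ), ((t ^ (a - 1) : ℝ) : ℂ) *
      Complex.exp (-((1 - ρ * Complex.I) * t)) with hF
  have hw : ∀ ρ : ℝ, (1 - ρ * Complex.I) ∈ Complex.slitPlane := by
    intro ρ; left; simp
  have parts : ∀ ρ : ℝ, ∫ t in Set.Ioi (0:ℝ), ((t ^ a : ℝ) : ℂ) *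
      Complex.exp (-((1 - ρ * Complex.I) * t)) = a / (1 - ρ * Complex.I) * F ρ := by
    intro ρ
    set w := 1 - ρ * Complex.I with hwd
    have hw0 : w ≠ 0 := Complex.slitPlane_ne_zero (hw ρ)
    have i2 := hInt a ha ρ
    have i1 := hInt (a + 1) (by linarith) ρ
    rw [← hwd] at i1 i2
    simp only [add_sub_cancel_right] at i1
    have e1 : Tendsto (fun t : ℝ => ((t ^ a : ℝ) : ℂ) * (-Complex.exp (-(w * t)) / w))
        (𝓝[>] 0) (𝓝 0) := by
      have : ContinuousAt (fun t : ℝ => ((t ^ a : ℝ) : ℂ) * (-Complex.exp (-(w * t)) / w)) 0 := by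
        have := continuousAt_rpow_const 0 a (Or.inr ha.le)
        fun_prop
      have h := this.tendsto.mono_left (nhdsWithin_le_nhds (s := Set.Ioi 0))
      simpa [zero_rpow ha.ne'] using h
    have e2 : Tendsto (fun t : ℝ => ((t ^ a : ℝ) : ℂ) * (-Complex.exp (-(w * t)) / w))
        atTop (𝓝 0) := by
      rw [tendsto_zero_iff_norm_tendsto_zero]
      have h := (tendsto_rpow_mul_exp_neg_mul_atTop_nhds_zero a 1 one_pos).div_const ‖w‖
      rw [zero_div] at h
      refine h.congr' ?_
      filter_upwards [eventually_gt_atTop 0] with t ht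
      have := hnorm a ρ t ht
      rw [norm_mul] at this
      rw [norm_mul, norm_div, norm_neg, mul_div_assoc', this, neg_mul]
    have := integral_Ioi_mul_deriv_eq_deriv_mul (a := (0:ℝ))
      (u := fun t : ℝ => ((t ^ a : ℝ) : ℂ)) (u' := fun t => ((a * t ^ (a - 1) : ℝ) : ℂ))
      (v := fun t : ℝ => -Complex.exp (-(w * t)) / w) (v' := fun t => Complex.exp (-(w * t)))
      ?_ ?_ i1 ?_ e1 e2
    · rw [this, hF]
      simp only
      rw [← hwd, ← integral_const_mul, sub_zero, zero_sub, ← integral_neg]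
      congr 1; ext t; push_cast; field_simp
    · intro t ht
      exact (hasDerivAt_rpow_const (Or.inl (ne_of_gt ht))).ofReal_comp
    · intro t ht
      have h1 : HasDerivAt (fun t : ℝ => -(w * (t:ℂ))) (-w) t := by
        simpa using! ((Complex.ofRealCLM.hasDerivAt (x := t)).const_mul w).neg
      exact ((h1.cexp.neg).div_const w).congr_deriv (by field_simp)
    · have := i2.mul_const (-(a:ℂ) / w)
      refine this.congr (ae_of_all _ fun t => ?_)
      simp only [Pi.mul_apply]; push_cast; field_simp
  have hder : ∀ ρ : ℝ, HasDerivAt F (Complex.I * (a / (1 - ρ * Complex.I) * F ρ)) ρ := by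
    intro ρ
    have := (hasDerivAt_integral_of_dominated_loc_of_deriv_le (μ := volume.restrict (Set.Ioi (0:ℝ)))
      (F := fun (ρ : ℝ) (t : ℝ) => ((t ^ (a - 1) : ℝ) : ℂ) *
        Complex.exp (-((1 - ρ * Complex.I) * t)))
      (F' := fun (ρ : ℝ) (t : ℝ) => Complex.I * (((t ^ a : ℝ) : ℂ) *
        Complex.exp (-((1 - ρ * Complex.I) * t)))) (x₀ := ρ) (s := Set.univ)
      (bound := fun t => t ^ (a + 1 - 1) * exp (-(1 * t))) univ_mem ?_ (hInt a ha ρ) ?_ ?_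
      (int_rpow_exp (by linarith) one_pos) ?_).2
    · rw [integral_const_mul, parts ρ] at this
      exact this
    · exact Eventually.of_forall fun ρ => Measurable.aestronglyMeasurable (by fun_prop)
    · exact Measurable.aestronglyMeasurable (by fun_prop)
    · filter_upwards [ae_restrict_mem measurableSet_Ioi] with t ht ρ _
      rw [norm_mul, Complex.norm_I, one_mul, hnorm _ _ _ ht, add_sub_cancel_right]
    · filter_upwards [ae_restrict_mem measurableSet_Ioi] with t ht ρ _
      have ht : 0 < t := ht
      have h1 : HasDerivAt (fun ρ : ℝ => -((1 - (ρ:ℂ) * Complex.I) * t)) (Complex.I * t) ρ := by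
        have := ((((Complex.ofRealCLM.hasDerivAt (x := ρ)).mul_const Complex.I).const_sub
          1).mul_const (t:ℂ)).neg
        simpa using! this
      refine (h1.cexp.const_mul (((t ^ (a - 1) : ℝ) : ℂ))).congr_deriv ?_
      have : t ^ a = t ^ (a - 1) * t := by
        rw [rpow_sub_one ht.ne']; field_simp
      rw [this]; push_cast; ring
  have hG : ∀ ρ : ℝ, HasDerivAt (fun ρ : ℝ => F ρ *
      Complex.exp (a * Complex.log (1 - ρ * Complex.I))) 0 ρ := by
    intro ρ
    have hw0 := Complex.slitPlane_ne_zero (hw ρ)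
    have h1 : HasDerivAt (fun ρ : ℝ => (1 - (ρ:ℂ) * Complex.I)) (-Complex.I) ρ := by
      have := (((Complex.ofRealCLM.hasDerivAt (x := ρ)).mul_const Complex.I).const_sub 1)
      simpa using this
    have h2 := ((h1.clog_real (hw ρ)).const_mul (a:ℂ)).cexp
    refine ((hder ρ).mul h2).congr_deriv ?_
    field_simp
    ring
  have hc := is_const_of_deriv_eq_zero (fun x => (hG x).differentiableAt)
    (fun x => (hG x).deriv) ρ 0
  refine hc.trans ?_
  have hr := integral_rpow_mul_exp_neg_mul_Ioi ha one_pos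
  simp only [div_one, one_rpow, one_mul] at hr
  rw [← hr, ← integral_complex_ofReal]
  simp [hF]

lemma gamma_sin {a : ℝ} (ha : 0 < a) (ρ : ℝ) :
    IntegrableOn (fun t : ℝ => t ^ (a - 1) * (exp (-t) * sin (ρ * t))) (Set.Ioi 0) ∧
    ∫ t in Set.Ioi (0:ℝ), t ^ (a - 1) * (exp (-t) * sin (ρ * t)) =
      Gamma a * (1 + ρ ^ 2) ^ (-a / 2) * sin (a * arctan ρ) := by
  obtain ⟨h1, h2⟩ := gammaF ha ρ
  have e2 : ∀ t : ℝ, (((t ^ (a - 1) : ℝ) : ℂ) * Complex.exp (-((1 - ρ * Complex.I) * t))).im =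
      t ^ (a - 1) * (exp (-t) * sin (ρ * t)) := by
    intro t; rw [Complex.im_ofReal_mul, Complex.exp_im]; simp
  constructor
  · simpa only [RCLike.im_to_complex, e2] using! h1.im
  · have hpos : 0 < 1 + ρ ^ 2 := by positivity
    have hlog : Complex.log (1 - ρ * Complex.I) = ((log (1 + ρ ^ 2) / 2 : ℝ) : ℂ) -
        (arctan ρ : ℝ) * Complex.I := by
      have hn : ‖(1 - ρ * Complex.I : ℂ)‖ = √(1 + ρ ^ 2) := by
        rw [Complex.norm_def]; congr 1; simp [Complex.normSq_apply]; ring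
      have harg : Complex.arg (1 - ρ * Complex.I) = - arctan ρ := by
        rw [Complex.arg_of_re_nonneg (by simp), hn, arctan_eq_arcsin, ← arcsin_neg]
        congr 1; simp; ring
      rw [Complex.log, hn, harg, log_sqrt hpos.le]; push_cast; ring
    have hI : (∫ t in Set.Ioi (0:ℝ), ((t ^ (a - 1) : ℝ) : ℂ) *
        Complex.exp (-((1 - ρ * Complex.I) * t))) =
        ((Gamma a : ℝ) : ℂ) * Complex.exp (-(a * Complex.log (1 - ρ * Complex.I))) := by
      rw [← h2, mul_assoc, ← Complex.exp_add]; simp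
    have : ∫ t in Set.Ioi (0:ℝ), t ^ (a - 1) * (exp (-t) * sin (ρ * t)) =
        (((Gamma a : ℝ) : ℂ) * Complex.exp (-(a * Complex.log (1 - ρ * Complex.I)))).im := by
      rw [← hI, ← Complex.imCLM_apply, ← Complex.imCLM.integral_comp_comm h1]
      simp only [Complex.imCLM_apply, e2]
    rw [this, Complex.im_ofReal_mul, hlog, Complex.exp_im, rpow_def_of_pos hpos, mul_assoc]
    congr 2
    · simp [-Complex.ofReal_arctan]; ring
    · congr 1; simp [-Complex.ofReal_arctan]
lemma main1 {α : ℝ} (h0 : 0 < α) (h2 : α < 2) {ρ : ℝ} (hρ : 0 < ρ) :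
    IntegrableOn (fun r : ℝ => (((1 + ρ ^ 2) ^ 2)⁻¹ - ((1 + (ρ - r) ^ 2) * (1 + (ρ + r) ^ 2))⁻¹) *
      r ^ (-(1 + α))) (Set.Ioi 0) ∧
    ∫ r in Set.Ioi (0:ℝ), (((1 + ρ ^ 2) ^ 2)⁻¹ - ((1 + (ρ - r) ^ 2) * (1 + (ρ + r) ^ 2))⁻¹) *
      r ^ (-(1 + α)) = (Gamma (α / 2) * Gamma (1 - α / 2) / 2 / Gamma (2 + α)) *
        (Gamma (2 + α) * (1 + ρ ^ 2) ^ (-(2 + α) / 2) * sin ((2 + α) * arctan ρ)) / (2 * ρ) := by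
  obtain ⟨j1, j2⟩ := J_int h0 h2
  set J := Gamma (α / 2) * Gamma (1 - α / 2) / 2 / Gamma (2 + α) with hJ
  have scal : ∀ k r : ℝ, 0 < k → 0 < r → (k * r - sin (k * r)) * r ^ (-(2 + α)) =
      k ^ (2 + α) * ((k * r - sin (k * r)) * (k * r) ^ (-(2 + α))) := by
    intro k r hk hr
    rw [mul_rpow hk.le hr.le, rpow_neg hk.le]
    have : 0 < k ^ (2 + α) := by positivity
    field_simp
  have hk1 : ∀ k : ℝ, 0 < k →
      IntegrableOn (fun r => (k * r - sin (k * r)) * r ^ (-(2 + α))) (Set.Ioi 0) ∧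
      ∫ r in Set.Ioi (0:ℝ), (k * r - sin (k * r)) * r ^ (-(2 + α)) = k ^ (1 + α) * J := by
    intro k hk
    have i := (integrableOn_Ioi_comp_mul_left_iff
      (fun t : ℝ => (t - sin t) * t ^ (-(2 + α))) 0 hk).2 (by simpa using j1)
    have v := integral_comp_mul_left_Ioi (fun t : ℝ => (t - sin t) * t ^ (-(2 + α))) 0 hk
    have e : Set.EqOn (fun r => k ^ (2 + α) * ((k * r - sin (k * r)) * (k * r) ^ (-(2 + α))))
      (fun r => (k * r - sin (k * r)) * r ^ (-(2 + α))) (Set.Ioi 0) :=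
      fun r hr => (scal k r hk hr).symm
    refine ⟨IntegrableOn.congr_fun (i.const_mul _) e measurableSet_Ioi, ?_⟩
    rw [← setIntegral_congr_fun measurableSet_Ioi e, integral_const_mul, v, mul_zero, j2,
      show 2 + α = (1 + α) + 1 by ring, rpow_add_one hk.ne', smul_eq_mul]
    field_simp
  have hr1 : ∀ r : ℝ, 0 < r → ∫ k in Set.Ioi (0:ℝ),
      (exp (-k) * sin (ρ * k)) * ((k * r - sin (k * r)) * r ^ (-(2 + α))) =
      ((((1 + ρ ^ 2) ^ 2)⁻¹ - ((1 + (ρ - r) ^ 2) * (1 + (ρ + r) ^ 2))⁻¹) *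
      r ^ (-(1 + α))) * (2 * ρ) := by
    intro r hr
    obtain ⟨i1, v1⟩ := gamma_sin two_pos ρ
    obtain ⟨i2, v2⟩ := (int_exp_cos_sin one_pos (ρ - r)).1
    obtain ⟨i3, v3⟩ := (int_exp_cos_sin one_pos (ρ + r)).1
    have e : ∀ k : ℝ, (exp (-k) * sin (ρ * k)) * ((k * r - sin (k * r)) * r ^ (-(2 + α))) =
        r ^ (-(2 + α)) * (r * (k ^ ((2:ℝ) - 1) * (exp (-k) * sin (ρ * k))) -
          (1 / 2) * (exp (-(1 * k)) * cos ((ρ - r) * k) - exp (-(1 * k)) * cos ((ρ + r) * k))) := by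
      intro k
      rw [show (2:ℝ) - 1 = 1 by norm_num, rpow_one, one_mul, sub_mul ρ r k, add_mul ρ r k, cos_add, cos_sub,
        mul_comm r k]
      ring
    have hs : sin (2 * arctan ρ) = 2 * ρ / (1 + ρ ^ 2) := by
      rw [sin_two_mul, sin_arctan, cos_arctan]
      have := sq_sqrt (show 0 ≤ 1 + ρ ^ 2 by positivity)
      have h : 0 < √(1 + ρ ^ 2) := by positivity
      field_simp
      rw [this]
    simp only [e]
    have i23 : IntegrableOn (fun k => (1 / 2) * (exp (-(1 * k)) * cos ((ρ - r) * k) -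
      exp (-(1 * k)) * cos ((ρ + r) * k))) (Set.Ioi 0) := (i2.sub i3).const_mul _
    rw [integral_const_mul, integral_sub (i1.const_mul r) i23, integral_const_mul,
      integral_const_mul, integral_sub i2 i3, v1, v2, v3, hs, Gamma_two,
      show -(2:ℝ) / 2 = -1 by norm_num, rpow_neg_one,
      show -(1 + α) = -(2 + α) + 1 by ring, rpow_add_one hr.ne']
    have p1 : 0 < 1 + (ρ - r) ^ 2 := by positivity
    have p2 : 0 < 1 + (ρ + r) ^ 2 := by positivity
    have p3 : 0 < 1 + ρ ^ 2 := by positivity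
    simp only [one_pow]
    field_simp
    ring
  obtain ⟨s1, s2⟩ := gamma_sin (a := 2 + α) (by linarith) ρ
  have key := swapH (fun k r => (exp (-k) * sin (ρ * k)) * ((k * r - sin (k * r)) *
      r ^ (-(2 + α)))) (by unfold Function.uncurry; fun_prop)
    (fun k => |k ^ (2 + α - 1) * (exp (-k) * sin (ρ * k))| * J)
    (fun k hk => (hk1 k hk).1.const_mul _) ?_ (s1.abs.mul_const _)
  · have k1 := key.1.congr_fun (fun r hr => hr1 r hr) measurableSet_Ioi
    have k2 := key.2
    rw [setIntegral_congr_fun measurableSet_Ioi (fun r hr => hr1 r hr), integral_mul_const] at k2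
    have e : Set.EqOn (fun k => ∫ r in Set.Ioi (0:ℝ), (exp (-k) * sin (ρ * k)) *
        ((k * r - sin (k * r)) * r ^ (-(2 + α))))
        (fun k => (k ^ (2 + α - 1) * (exp (-k) * sin (ρ * k))) * J) (Set.Ioi 0) := by
      intro k hk
      simp only
      rw [integral_const_mul, (hk1 k hk).2, show 2 + α - 1 = 1 + α by ring]
      ring
    rw [setIntegral_congr_fun measurableSet_Ioi e, integral_mul_const, s2] at k2
    constructor
    · have := k1.mul_const (2 * ρ)⁻¹
      refine this.congr (ae_of_all _ fun r => ?_)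
      simp only
      rw [mul_assoc, mul_inv_cancel₀ (by positivity), mul_one]
    · rw [mul_comm J, ← k2]; field_simp
  · intro k hk
    simp only [abs_mul (rexp (-k) * sin (ρ * k))]
    rw [integral_const_mul]
    have : ∫ r in Set.Ioi (0:ℝ), |(k * r - sin (k * r)) * r ^ (-(2 + α))| = k ^ (1 + α) * J := by
      rw [← (hk1 k hk).2]
      refine setIntegral_congr_fun measurableSet_Ioi (fun r hr => ?_)
      have hr : (0:ℝ) < r := hr
      have := sin_le (mul_pos hk hr).le
      exact abs_of_nonneg (mul_nonneg (by linarith) (by positivity))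
    rw [this, abs_mul (k ^ (2 + α - 1)), abs_of_pos (rpow_pos_of_pos hk _),
      show 2 + α - 1 = 1 + α by ring]
    ring

lemma const_eq {α : ℝ} (h0 : 0 < α) (h2 : α < 2) :
    fracLapConst 3 α * (4 * π * (Gamma (α / 2) * Gamma (1 - α / 2) / 2 / Gamma (2 + α))) = 1 := by
  have d := Gamma_mul_Gamma_add_half_of_pos (s := 1 + α / 2) (by linarith)
  have g1 : 0 < Gamma (2 + α) := Gamma_pos_of_pos (by linarith)
  have g2 : 0 < Gamma (1 - α / 2) := Gamma_pos_of_pos (by linarith)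
  have g3 : Gamma (α / 2 + 1) = α / 2 * Gamma (α / 2) := Gamma_add_one (by linarith)
  rw [show 1 + α / 2 + 1 / 2 = (α + 3) / 2 by ring, show 2 * (1 + α / 2) = 2 + α by ring,
    show 1 - (2 + α) = -(α + 1) by ring, add_comm 1, g3, rpow_neg two_pos.le,
    rpow_add_one two_ne_zero] at d
  have hp : π ^ ((3:ℝ) / 2) = π * √π := by
    rw [show (3:ℝ) / 2 = 1 + 1 / 2 by norm_num, rpow_add pi_pos, rpow_one, sqrt_eq_rpow]
  unfold fracLapConst
  generalize Gamma (1 - α / 2) = G at g2 ⊢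
  push_cast
  rw [hp, rpow_sub_one two_ne_zero]
  have q : 0 < (2:ℝ) ^ α := by positivity
  have sp : 0 < √π := by positivity
  have pp := pi_pos
  field_simp at d ⊢
  linarith

noncomputable def sphDens (p : ℝ × ℝ) : NNReal :=
  if |p.1| < p.2 then (2 * π * p.2).toNNReal else 0

lemma sphDens_meas : Measurable sphDens := by
  unfold sphDens
  refine Measurable.ite ?_ (by fun_prop) (by fun_prop)
  exact measurableSet_lt (by fun_prop) (by fun_prop)

lemma sph_sub (s : ℝ) (h : ℝ → ENNReal) :
    ∫⁻ q in Set.Ioi (0:ℝ), ENNReal.ofReal q * h (√(s ^ 2 + q ^ 2)) =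
      ∫⁻ r in Set.Ioi |s|, ENNReal.ofReal r * h r := by
  have hpos : ∀ q : ℝ, 0 < q → 0 < s ^ 2 + q ^ 2 := fun q hq => by positivity
  have him : (fun q : ℝ => √(s ^ 2 + q ^ 2)) '' Set.Ioi 0 = Set.Ioi |s| := by
    ext r
    simp only [Set.mem_image, Set.mem_Ioi]
    constructor
    · rintro ⟨q, hq, rfl⟩
      refine lt_sqrt_of_sq_lt ?_
      rw [sq_abs]
      have : 0 < q ^ 2 := by positivity
      linarith
    · intro hr
      have h0 : 0 < r := (abs_nonneg s).trans_lt hr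
      have h1 : s ^ 2 < r ^ 2 := sq_lt_sq.2 (by rwa [abs_of_pos h0])
      refine ⟨√(r ^ 2 - s ^ 2), sqrt_pos.2 (by linarith), ?_⟩
      rw [sq_sqrt (by linarith), add_sub_cancel, sqrt_sq h0.le]
  rw [← him, lintegral_image_eq_lintegral_deriv_mul_of_monotoneOn
    (f' := fun q => q / √(s ^ 2 + q ^ 2)) measurableSet_Ioi]
  · refine setLIntegral_congr_fun measurableSet_Ioi (fun q hq => ?_)
    have hq : (0:ℝ) < q := hq
    have h1 : 0 < √(s ^ 2 + q ^ 2) := sqrt_pos.2 (hpos q hq)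
    rw [← mul_assoc, ← ENNReal.ofReal_mul (by positivity), div_mul_cancel₀ _ h1.ne']
  · intro q hq
    have hq : (0:ℝ) < q := hq
    have h1 : HasDerivAt (fun q : ℝ => s ^ 2 + q ^ 2) (2 * q) q := by
      simpa using! ((hasDerivAt_pow 2 q).const_add (s ^ 2))
    refine ((h1.sqrt (hpos q hq).ne').congr_deriv ?_).hasDerivWithinAt
    field_simp
  · intro a ha b hb hab
    have ha : (0:ℝ) < a := ha
    exact sqrt_le_sqrt (by nlinarith)

lemma sph_polar (g : ℝ → ENNReal) (hg : Measurable g) :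
    ∫⁻ a : ℝ × ℝ, g (a.1 ^ 2 + a.2 ^ 2) =
      ENNReal.ofReal (2 * π) * ∫⁻ q in Set.Ioi (0:ℝ), ENNReal.ofReal q * g (q ^ 2) := by
  rw [← lintegral_comp_polarCoord_symm]
  have e : ∀ p : ℝ × ℝ, ENNReal.ofReal p.1 • g ((polarCoord.symm p).1 ^ 2 +
      (polarCoord.symm p).2 ^ 2) = ENNReal.ofReal p.1 * g (p.1 ^ 2) := by
    intro p
    simp only [polarCoord_symm_apply, smul_eq_mul]
    congr 2
    linear_combination p.1 ^ 2 * cos_sq_add_sin_sq p.2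
  simp only [e]
  rw [polarCoord_target, Measure.volume_eq_prod, ← Measure.prod_restrict,
    lintegral_prod _ (by fun_prop)]
  simp only [lintegral_const, Measure.restrict_apply_univ, Real.volume_Ioo]
  rw [lintegral_mul_const _ (by fun_prop), mul_comm, show π - -π = 2 * π by ring]

lemma sph_map (e : EuclideanSpace ℝ (Fin 3)) (he : ‖e‖ = 1) :
    Measure.map (fun z : EuclideanSpace ℝ (Fin 3) => (inner ℝ e z, ‖z‖)) volume =
      (volume : Measure (ℝ × ℝ)).withDensity (fun p => (sphDens p : ENNReal)) := by
  have hφ : Measurable (fun z : EuclideanSpace ℝ (Fin 3) => (inner ℝ e z, ‖z‖)) := by fun_prop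
  refine Measure.ext_of_lintegral _ (fun H hH => ?_)
  rw [lintegral_map hH hφ]
  obtain ⟨b, hb⟩ := Orthonormal.exists_orthonormalBasis_extension_of_card_eq (𝕜 := ℝ)
    (E := EuclideanSpace ℝ (Fin 3)) (ι := Fin 3) (by simp) (v := fun _ => e) (s := {0})
    (by
      refine ⟨fun i => by simpa using he, fun i j hij => ?_⟩
      exact absurd (Subsingleton.elim i j) hij)
  have hb0 : b 0 = e := hb 0 rfl
  have h1 : ∫⁻ z : EuclideanSpace ℝ (Fin 3), H (inner ℝ e z, ‖z‖) =
      ∫⁻ v : Fin 3 → ℝ, H (v 0, √(v 0 ^ 2 + (v 1 ^ 2 + v 2 ^ 2))) := by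
    rw [← ((PiLp.volume_preserving_ofLp (Fin 3)).comp b.measurePreserving_repr).lintegral_comp
      (by fun_prop)]
    refine lintegral_congr (fun z => ?_)
    simp only [Function.comp]
    congr 2
    · rw [← hb0, b.repr_apply_apply]
    · rw [← b.repr.norm_map z, EuclideanSpace.norm_eq]
      simp [Fin.sum_univ_three, add_assoc]
  have h2 : ∫⁻ v : Fin 3 → ℝ, H (v 0, √(v 0 ^ 2 + (v 1 ^ 2 + v 2 ^ 2))) =
      ∫⁻ p : ℝ × (Fin 2 → ℝ), H (p.1, √(p.1 ^ 2 + (p.2 0 ^ 2 + p.2 1 ^ 2))) := by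
    rw [← (volume_preserving_piFinSuccAbove (fun _ : Fin 3 => ℝ) 0).lintegral_comp
      (by fun_prop)]
    rfl
  have h3 : ∀ s : ℝ, ∫⁻ p : Fin 2 → ℝ, H (s, √(s ^ 2 + (p 0 ^ 2 + p 1 ^ 2))) =
      ∫⁻ a : ℝ × ℝ, H (s, √(s ^ 2 + (a.1 ^ 2 + a.2 ^ 2))) := by
    intro s
    rw [← (volume_preserving_finTwoArrow ℝ).lintegral_comp (by fun_prop)]
    rfl
  rw [h1, h2, Measure.volume_eq_prod, lintegral_prod _ (by fun_prop),
    lintegral_withDensity_eq_lintegral_mul _ sphDens_meas.coe_nnreal_ennreal hH,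
    Measure.volume_eq_prod,
    lintegral_prod _ ((sphDens_meas.coe_nnreal_ennreal.mul hH).aemeasurable)]
  refine lintegral_congr (fun s => ?_)
  rw [h3 s, sph_polar (fun t => H (s, √(s ^ 2 + t))) (by fun_prop),
    sph_sub s (fun r => H (s, r)), ← lintegral_const_mul _ (by fun_prop),
    ← lintegral_indicator measurableSet_Ioi]
  refine lintegral_congr (fun r => ?_)
  by_cases h : |s| < r
  · have hr : 0 < r := (abs_nonneg s).trans_lt h
    rw [Set.indicator_of_mem (by exact h)]
    simp only [Pi.mul_apply, sphDens, h, if_true]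
    rw [← mul_assoc, ← ENNReal.ofReal_mul (by positivity)]
    rfl
  · rw [Set.indicator_of_notMem (by exact h)]
    simp [sphDens, h]

lemma sph_inner {ρ r : ℝ} (hρ : 0 < ρ) (hr : 0 < r) :
    ∫ s in Set.Ioo (-r) r, ((((1 + ρ ^ 2) ^ 2)⁻¹) - ((1 + (ρ ^ 2 - 2 * (ρ * s) + r ^ 2)) ^ 2)⁻¹) =
      2 * r * (((1 + ρ ^ 2) ^ 2)⁻¹ - ((1 + (ρ - r) ^ 2) * (1 + (ρ + r) ^ 2))⁻¹) := by
  have hle : -r ≤ r := by linarith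
  rw [← integral_Ioc_eq_integral_Ioo, ← intervalIntegral.integral_of_le hle]
  have pos : ∀ s ∈ Set.uIcc (-r) r, 0 < 1 + (ρ ^ 2 - 2 * (ρ * s) + r ^ 2) := by
    intro s hs
    rw [Set.uIcc_of_le hle] at hs
    nlinarith [hs.2, sq_nonneg (ρ - r), mul_le_mul_of_nonneg_left hs.2 hρ.le]
  rw [intervalIntegral.integral_eq_sub_of_hasDerivAt
    (f := fun s => ((1 + ρ ^ 2) ^ 2)⁻¹ * s - (1 + (ρ ^ 2 - 2 * (ρ * s) + r ^ 2))⁻¹ / (2 * ρ))]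
  · have p1 : 0 < 1 + (ρ - r) ^ 2 := by positivity
    have p2 : 0 < 1 + (ρ + r) ^ 2 := by positivity
    rw [show 1 + (ρ ^ 2 - 2 * (ρ * r) + r ^ 2) = 1 + (ρ - r) ^ 2 by ring,
      show 1 + (ρ ^ 2 - 2 * (ρ * -r) + r ^ 2) = 1 + (ρ + r) ^ 2 by ring]
    field_simp
    ring
  · intro s hs
    have h := pos s hs
    have h1 : HasDerivAt (fun s => 1 + (ρ ^ 2 - 2 * (ρ * s) + r ^ 2)) (-(2 * ρ)) s := by
      have := (((((hasDerivAt_id s).const_mul ρ).const_mul 2).const_sub (ρ ^ 2)).add_const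
        (r ^ 2)).const_add 1
      simpa using! this
    have h2 := ((hasDerivAt_id s).const_mul (((1 + ρ ^ 2) ^ 2)⁻¹)).sub
      ((h1.inv h.ne').div_const (2 * ρ))
    refine h2.congr_deriv ?_
    field_simp
  · refine ContinuousOn.intervalIntegrable ?_
    refine continuousOn_const.sub (ContinuousOn.inv₀ (by fun_prop) ?_)
    intro s hs
    have := pos s hs
    positivity

lemma pv_int {α : ℝ} (h0 : 0 < α) (x : EuclideanSpace ℝ (Fin 3)) (hx : x ≠ 0) {ε : ℝ}
    (hε : 0 < ε) :
    ∫ y in {y : EuclideanSpace ℝ (Fin 3) | ε < ‖x - y‖},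
      (((1 + ‖x‖ ^ 2) ^ 2)⁻¹ - ((1 + ‖y‖ ^ 2) ^ 2)⁻¹) / ‖x - y‖ ^ (3 + α) =
    4 * π * ∫ r in Set.Ioi ε, (((1 + ‖x‖ ^ 2) ^ 2)⁻¹ -
      ((1 + (‖x‖ - r) ^ 2) * (1 + (‖x‖ + r) ^ 2))⁻¹) * r ^ (-(1 + α)) := by
  have hρ : 0 < ‖x‖ := norm_pos_iff.2 hx
  set ρ := ‖x‖ with hρd
  set e : EuclideanSpace ℝ (Fin 3) := ρ⁻¹ • x with hed
  have he : ‖e‖ = 1 := by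
    rw [hed, norm_smul, norm_inv, norm_of_nonneg hρ.le, inv_mul_cancel₀ hρ.ne']
  have hxe : x = ρ • e := by rw [hed, smul_inv_smul₀ hρ.ne']
  set G : ℝ × ℝ → ℝ := fun p => if ε < p.2 then
    ((((1 + ρ ^ 2) ^ 2)⁻¹) - ((1 + (ρ ^ 2 - 2 * (ρ * p.1) + p.2 ^ 2)) ^ 2)⁻¹) / p.2 ^ (3 + α)
    else 0 with hG
  have hGm : Measurable G := by
    refine Measurable.ite (measurableSet_lt (by fun_prop) (by fun_prop)) (by fun_prop)
      (by fun_prop)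
  set φ : EuclideanSpace ℝ (Fin 3) → ℝ × ℝ := fun z => (inner ℝ e z, ‖z‖) with hφd
  have hφ : Measurable φ := by fun_prop
  have hn : ∀ z, ‖x - z‖ ^ 2 = ρ ^ 2 - 2 * (ρ * inner ℝ e z) + ‖z‖ ^ 2 := by
    intro z
    rw [norm_sub_sq_real, ← hρd]
    conv_lhs => rw [hxe, real_inner_smul_left]
  have hGz : ∀ z, G (φ z) = if ε < ‖z‖ then
      (((1 + ρ ^ 2) ^ 2)⁻¹ - ((1 + ‖x - z‖ ^ 2) ^ 2)⁻¹) / ‖z‖ ^ (3 + α) else 0 := by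
    intro z
    simp only [hG, hφd, hn]
  have hstep1 : ∫ y in {y : EuclideanSpace ℝ (Fin 3) | ε < ‖x - y‖},
      (((1 + ρ ^ 2) ^ 2)⁻¹ - ((1 + ‖y‖ ^ 2) ^ 2)⁻¹) / ‖x - y‖ ^ (3 + α) =
      ∫ z, G (φ z) := by
    rw [← integral_sub_left_eq_self (fun z => G (φ z)) volume x,
      ← integral_indicator (measurableSet_lt (by fun_prop) (by fun_prop))]
    refine integral_congr_ae (ae_of_all _ fun y => ?_)
    simp only [hGz, Set.indicator, Set.mem_ofPred_eq, sub_sub_cancel]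
  have hInt : Integrable (G ∘ φ) := by
    have hb : Integrable (fun z : EuclideanSpace ℝ (Fin 3) =>
        ((1 + ε) / ε) ^ (3 + α) * (1 + ‖z‖) ^ (-(3 + α))) :=
      (integrable_one_add_norm (by simp; linarith)).const_mul _
    refine hb.mono' (hGm.comp hφ).aestronglyMeasurable (ae_of_all _ fun z => ?_)
    simp only [Function.comp, hGz]
    split_ifs with h
    · have hz : 0 < ‖z‖ := hε.trans h
      have b : ∀ t : ℝ, 0 ≤ ((1 + t ^ 2) ^ 2)⁻¹ ∧ ((1 + t ^ 2) ^ 2)⁻¹ ≤ 1 := fun t =>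
        ⟨by positivity, inv_le_one_of_one_le₀ (by nlinarith [sq_nonneg t])⟩
      have b1 := b ρ
      have b2 := b ‖x - z‖
      rw [norm_div, norm_of_nonneg (rpow_nonneg hz.le _), rpow_neg (by positivity),
        ← div_eq_mul_inv]
      have hnum : ‖((1 + ρ ^ 2) ^ 2)⁻¹ - ((1 + ‖x - z‖ ^ 2) ^ 2)⁻¹‖ ≤ 1 := by
        rw [norm_eq_abs, abs_le]
        constructor <;> linarith [b1.1, b1.2, b2.1, b2.2]
      refine (div_le_div_of_nonneg_right hnum (by positivity)).trans ?_
      rw [div_le_div_iff₀ (by positivity) (by positivity), one_mul,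
        ← mul_rpow (by positivity) hz.le]
      refine rpow_le_rpow (by positivity) ?_ (by linarith)
      rw [div_mul_eq_mul_div, le_div_iff₀ hε]
      nlinarith
    · simp only [norm_zero]; positivity
  have hInt2 : Integrable (fun p => sphDens p • G p) (volume : Measure (ℝ × ℝ)) := by
    rw [← integrable_withDensity_iff_integrable_smul sphDens_meas, ← sph_map e he]
    exact (integrable_map_measure hGm.aestronglyMeasurable hφ.aemeasurable).2 hInt
  rw [hstep1, ← integral_map hφ.aemeasurable hGm.aestronglyMeasurable, sph_map e he,
    integral_withDensity_eq_integral_smul sphDens_meas, Measure.volume_eq_prod,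
    integral_prod_symm _ (by rwa [Measure.volume_eq_prod] at hInt2), ← integral_const_mul,
    ← integral_indicator measurableSet_Ioi]
  refine integral_congr_ae (ae_of_all _ fun r => ?_)
  simp only
  by_cases h : ε < r
  · have hr : 0 < r := hε.trans h
    rw [Set.indicator_of_mem (by exact h)]
    have e1 : ∀ s : ℝ, sphDens (s, r) • G (s, r) = (Set.Ioo (-r) r).indicator (fun s =>
        (2 * π * r / r ^ (3 + α)) * ((((1 + ρ ^ 2) ^ 2)⁻¹) -
          ((1 + (ρ ^ 2 - 2 * (ρ * s) + r ^ 2)) ^ 2)⁻¹)) s := by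
      intro s
      by_cases hs : |s| < r
      · rw [Set.indicator_of_mem (by exact abs_lt.1 hs)]
        simp only [sphDens, hG, hs, h, if_true, NNReal.smul_def, smul_eq_mul]
        rw [coe_toNNReal _ (by positivity)]
        ring
      · rw [Set.indicator_of_notMem (by exact fun h => hs (abs_lt.2 h))]
        simp [sphDens, hs]
    simp only [e1]
    rw [integral_indicator measurableSet_Ioo, integral_const_mul, sph_inner hρ hr,
      show 3 + α = (1 + α) + 2 by ring, rpow_add hr, rpow_neg hr.le, rpow_two]
    field_simp
    ring
  · rw [Set.indicator_of_notMem (by exact h)]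
    simp [hG, h]

/-- For `α ∈ (0,2)` and `u(x) = (1+|x|²)^{-2}` on `ℝ³`, at every `x ≠ 0` the
principal value limit defining the fractional Laplacian of `u` at `x` exists and equals
`Γ(2+α) (1+|x|²)^{-(2+α)/2} sin((2+α) arctan|x|) / (2|x|)`. -/
theorem fracLap_GIMQ_3d (α : ℝ) (hα : α ∈ Set.Ioo (0 : ℝ) 2)
    (u : EuclideanSpace ℝ (Fin 3) → ℝ) (hu : ∀ x, u x = ((1 + ‖x‖ ^ 2) ^ 2)⁻¹)
    (x : EuclideanSpace ℝ (Fin 3)) (hx : x ≠ 0) :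
    Tendsto
      (fun ε : ℝ => fracLapConst 3 α *
        ∫ y in {y : EuclideanSpace ℝ (Fin 3) | ε < ‖x - y‖},
          (u x - u y) / ‖x - y‖ ^ (3 + α))
      (𝓝[>] 0)
      (𝓝 (Real.Gamma (2 + α) * (1 + ‖x‖ ^ 2) ^ (-(2 + α) / 2) *
        Real.sin ((2 + α) * Real.arctan ‖x‖) / (2 * ‖x‖))) := by
  obtain ⟨h0, h2⟩ := hα
  have hρ : 0 < ‖x‖ := norm_pos_iff.2 hx
  obtain ⟨m1, m2⟩ := main1 h0 h2 hρ
  set F : ℝ → ℝ := fun r => (((1 + ‖x‖ ^ 2) ^ 2)⁻¹ -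
      ((1 + (‖x‖ - r) ^ 2) * (1 + (‖x‖ + r) ^ 2))⁻¹) * r ^ (-(1 + α)) with hF
  have hc : AECover (volume.restrict (Set.Ioi (0:ℝ))) (𝓝[>] (0:ℝ)) (fun ε => Set.Ioi ε) :=
    aecover_Ioi_of_Ioi (tendsto_id.mono_left nhdsWithin_le_nhds)
  have ht := hc.integral_tendsto_of_countably_generated m1
  have ht2 := (ht.const_mul (4 * π)).const_mul (fracLapConst 3 α)
  rw [m2] at ht2
  have hval : fracLapConst 3 α * (4 * π * (Gamma (α / 2) * Gamma (1 - α / 2) / 2 / Gamma (2 + α) *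
      (Gamma (2 + α) * (1 + ‖x‖ ^ 2) ^ (-(2 + α) / 2) * sin ((2 + α) * arctan ‖x‖)) /
        (2 * ‖x‖))) = Real.Gamma (2 + α) * (1 + ‖x‖ ^ 2) ^ (-(2 + α) / 2) *
        Real.sin ((2 + α) * Real.arctan ‖x‖) / (2 * ‖x‖) := by
    have := const_eq h0 h2
    generalize Gamma (α / 2) * Gamma (1 - α / 2) / 2 / Gamma (2 + α) = K at this ⊢
    linear_combination (Real.Gamma (2 + α) * (1 + ‖x‖ ^ 2) ^ (-(2 + α) / 2) *
        Real.sin ((2 + α) * Real.arctan ‖x‖) / (2 * ‖x‖)) * this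
  rw [hval] at ht2
  refine ht2.congr' ?_
  filter_upwards [self_mem_nhdsWithin] with ε hε
  have hε : (0:ℝ) < ε := hε
  simp only [hu]
  rw [pv_int h0 x hx hε, Measure.restrict_restrict measurableSet_Ioi,
    Set.inter_eq_left.2 (Set.Ioi_subset_Ioi hε.le)]
end

section
/- Let α ∈ (0, 2) and let u : ℝ³ → ℝ be given by u(y) = (1 + |y|²)^{-2}. Then the integral C_{3,α} · ∫_{ℝ³} (1 − (1 + |y|²)^{-2}) / |y|^{3+α} dy converges absolutely and equals Γ(3+α)/2; that is, the fractional Laplacian of u at the origin equals Γ(3+α)/2. -/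
open MeasureTheory Real

lemma aux_gamma_lintegral {a r : ℝ} (ha : 0 < a) (hr : 0 < r) :
    ∫⁻ t in Set.Ioi (0:ℝ), ENNReal.ofReal (t ^ (a - 1) * Real.exp (-(r * t))) =
      ENNReal.ofReal ((1 / r) ^ a * Real.Gamma a) := by
  rw [← Real.integral_rpow_mul_exp_neg_mul_Ioi ha hr]
  symm
  apply ofReal_integral_eq_lintegral_ofReal
  · have h := integrableOn_rpow_mul_exp_neg_mul_rpow (p := 1) (s := a - 1) (b := r)
      (by linarith) one_pos hr
    simpa [IntegrableOn] using h
  · filter_upwards [ae_restrict_mem measurableSet_Ioi] with t ht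
    have : (0:ℝ) < t := ht
    simp only [Pi.zero_apply]
    positivity

lemma aux_beta_lintegral {u v : ℝ} (hu : 0 < u) (hv : 0 < v) :
    ∫⁻ s in Set.Ioi (0:ℝ), ENNReal.ofReal
        (s ^ (u - 1) * ((1 / (1 + s)) ^ (u + v) * Real.Gamma (u + v))) =
      ENNReal.ofReal (Real.Gamma u * Real.Gamma v) := by
  have h1 : ∫⁻ s in Set.Ioi (0:ℝ), ENNReal.ofReal
        (s ^ (u - 1) * ((1 / (1 + s)) ^ (u + v) * Real.Gamma (u + v))) =
      ∫⁻ s in Set.Ioi (0:ℝ), ∫⁻ t in Set.Ioi (0:ℝ), ENNReal.ofReal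
        (s ^ (u - 1)) * ENNReal.ofReal (t ^ (u + v - 1) * Real.exp (-((1 + s) * t))) := by
    refine setLIntegral_congr_fun measurableSet_Ioi fun s hs => ?_
    have hs' : (0:ℝ) < s := hs
    rw [lintegral_const_mul _ (by fun_prop), aux_gamma_lintegral (by linarith) (by linarith),
      ENNReal.ofReal_mul (by positivity)]
  rw [h1, lintegral_lintegral_swap (by unfold Function.uncurry; fun_prop)]
  have h2 : ∀ t ∈ Set.Ioi (0:ℝ), ∫⁻ s in Set.Ioi (0:ℝ), ENNReal.ofReal
        (s ^ (u - 1)) * ENNReal.ofReal (t ^ (u + v - 1) * Real.exp (-((1 + s) * t))) =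
      ENNReal.ofReal (Real.Gamma u) * ENNReal.ofReal (t ^ (v - 1) * Real.exp (-(1 * t))) := by
    intro t ht
    have ht' : (0:ℝ) < t := ht
    have h3 : ∀ s ∈ Set.Ioi (0:ℝ), ENNReal.ofReal
        (s ^ (u - 1)) * ENNReal.ofReal (t ^ (u + v - 1) * Real.exp (-((1 + s) * t))) =
        ENNReal.ofReal (t ^ (u + v - 1) * Real.exp (-t)) *
          ENNReal.ofReal (s ^ (u - 1) * Real.exp (-(t * s))) := by
      intro s hs
      have hs' : (0:ℝ) < s := hs
      rw [← ENNReal.ofReal_mul (by positivity), ← ENNReal.ofReal_mul (by positivity)]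
      congr 1
      rw [show -((1 + s) * t) = -t + -(t * s) by ring, Real.exp_add]
      ring
    rw [setLIntegral_congr_fun measurableSet_Ioi h3, lintegral_const_mul _ (by fun_prop),
      aux_gamma_lintegral hu ht', ← ENNReal.ofReal_mul (by positivity),
      ← ENNReal.ofReal_mul (Real.Gamma_pos_of_pos hu).le]
    congr 1
    rw [one_div, Real.inv_rpow ht'.le, ← Real.rpow_neg ht'.le,
      show v - 1 = (u + v - 1) + -u by ring, Real.rpow_add ht', one_mul]
    ring
  rw [setLIntegral_congr_fun measurableSet_Ioi h2, lintegral_const_mul _ (by fun_prop),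
    aux_gamma_lintegral hv one_pos, ← ENNReal.ofReal_mul (Real.Gamma_pos_of_pos hu).le]
  simp

lemma aux_beta {u v : ℝ} (hu : 0 < u) (hv : 0 < v) :
    IntegrableOn (fun s : ℝ => s ^ (u - 1) * ((1 / (1 + s)) ^ (u + v) * Real.Gamma (u + v)))
      (Set.Ioi 0) ∧
    ∫ s in Set.Ioi (0:ℝ), s ^ (u - 1) * ((1 / (1 + s)) ^ (u + v) * Real.Gamma (u + v)) =
      Real.Gamma u * Real.Gamma v := by
  have hm : AEStronglyMeasurable
      (fun s : ℝ => s ^ (u - 1) * ((1 / (1 + s)) ^ (u + v) * Real.Gamma (u + v)))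
      (volume.restrict (Set.Ioi 0)) := by
    apply Measurable.aestronglyMeasurable
    fun_prop
  have h0 : 0 ≤ᵐ[volume.restrict (Set.Ioi 0)]
      (fun s : ℝ => s ^ (u - 1) * ((1 / (1 + s)) ^ (u + v) * Real.Gamma (u + v))) := by
    filter_upwards [ae_restrict_mem measurableSet_Ioi] with t ht
    have : (0:ℝ) < t := ht
    have := Real.Gamma_pos_of_pos (add_pos hu hv)
    simp only [Pi.zero_apply]
    positivity
  constructor
  · apply (lintegral_ofReal_ne_top_iff_integrable hm h0).1
    rw [aux_beta_lintegral hu hv]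
    exact ENNReal.ofReal_ne_top
  · rw [integral_eq_lintegral_of_nonneg_ae h0 hm, aux_beta_lintegral hu hv,
      ENNReal.toReal_ofReal (mul_pos (Real.Gamma_pos_of_pos hu) (Real.Gamma_pos_of_pos hv)).le]

/-- The radial integrand in the variable `s = r ^ 2`. -/
lemma aux_s {a : ℝ} (ha : 0 < a) (ha1 : a < 1) :
    IntegrableOn (fun s : ℝ => (1 - ((1 + s) ^ 2)⁻¹) * s ^ (-1 - a)) (Set.Ioi 0) ∧
    ∫ s in Set.Ioi (0:ℝ), (1 - ((1 + s) ^ 2)⁻¹) * s ^ (-1 - a) =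
      Real.Gamma (1 - a) * Real.Gamma (a + 2) / a := by
  obtain ⟨i1, e1⟩ := aux_beta (u := 1 - a) (v := a) (by linarith) ha
  obtain ⟨i2, e2⟩ := aux_beta (u := 1 - a) (v := a + 1) (by linarith) (by linarith)
  have h : Set.EqOn (fun s : ℝ =>
      s ^ (1 - a - 1) * ((1 / (1 + s)) ^ (1 - a + a) * Real.Gamma (1 - a + a)) +
      s ^ (1 - a - 1) * ((1 / (1 + s)) ^ (1 - a + (a + 1)) * Real.Gamma (1 - a + (a + 1))))
      (fun s : ℝ => (1 - ((1 + s) ^ 2)⁻¹) * s ^ (-1 - a)) (Set.Ioi 0) := by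
    intro s hs
    have hs' : (0:ℝ) < s := hs
    simp only
    rw [show 1 - a + a = 1 by ring, show 1 - a + (a + 1) = (2:ℝ) by ring,
      show 1 - a - 1 = (-1 - a) + 1 by ring, Real.rpow_add hs', Real.rpow_one, Real.rpow_one,
      Real.rpow_two, Real.Gamma_one, Real.Gamma_two]
    field_simp
    ring
  constructor
  · exact (i1.add i2).congr_fun h measurableSet_Ioi
  · rw [← setIntegral_congr_fun measurableSet_Ioi h, integral_add i1 i2, e1, e2,
      show a + 2 = (a + 1) + 1 by ring, Real.Gamma_add_one (s := a + 1) (by linarith),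
      Real.Gamma_add_one ha.ne']
    field_simp
    ring

lemma aux_r {α : ℝ} (hα : α ∈ Set.Ioo (0 : ℝ) 2) :
    IntegrableOn (fun r : ℝ => r ^ 2 • ((1 - ((1 + r ^ 2) ^ 2)⁻¹) / r ^ (3 + α))) (Set.Ioi 0) ∧
    ∫ r in Set.Ioi (0:ℝ), r ^ 2 • ((1 - ((1 + r ^ 2) ^ 2)⁻¹) / r ^ (3 + α)) =
      Real.Gamma (1 - α / 2) * Real.Gamma (α / 2 + 2) / α := by
  obtain ⟨h0, h2⟩ := hα
  obtain ⟨i, e⟩ := aux_s (a := α / 2) (by linarith) (by linarith)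
  have h : Set.EqOn (fun r : ℝ => ((2:ℝ) * r ^ ((2:ℝ) - 1)) •
        ((fun s : ℝ => (1 - ((1 + s) ^ 2)⁻¹) * s ^ (-1 - α / 2)) (r ^ (2:ℝ))))
      (fun r : ℝ => 2 * (r ^ 2 • ((1 - ((1 + r ^ 2) ^ 2)⁻¹) / r ^ (3 + α)))) (Set.Ioi 0) := by
    intro r hr
    have hr' : (0:ℝ) < r := hr
    simp only [smul_eq_mul]
    rw [← Real.rpow_mul hr'.le, Real.rpow_two, div_eq_mul_inv _ (r ^ (3 + α)), ← Real.rpow_neg hr'.le,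
      show (2:ℝ) * (-1 - α / 2) = -(3 + α) + 1 by ring, Real.rpow_add hr',
      show (2:ℝ) - 1 = 1 by norm_num, Real.rpow_one]
    ring
  constructor
  · have := (integrableOn_Ioi_comp_rpow_iff _ (p := 2) two_ne_zero).2 i
    rw [abs_of_pos two_pos] at this
    have h4 := (this.congr_fun h measurableSet_Ioi).const_mul (1/2)
    refine IntegrableOn.congr_fun h4 (fun r _ => ?_) measurableSet_Ioi
    ring
  · rw [← integral_comp_rpow_Ioi_of_pos two_pos,
      setIntegral_congr_fun measurableSet_Ioi h, integral_const_mul] at e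
    have h5 : Real.Gamma (1 - α / 2) * Real.Gamma (α / 2 + 2) / (α / 2) =
      2 * (Real.Gamma (1 - α / 2) * Real.Gamma (α / 2 + 2) / α) := by field_simp
    linarith

theorem fracLap_GIMQ_3d_at_origin (α : ℝ) (hα : α ∈ Set.Ioo (0 : ℝ) 2) :
    Integrable (fun y : EuclideanSpace ℝ (Fin 3) =>
      (1 - ((1 + ‖y‖ ^ 2) ^ 2)⁻¹) / ‖y‖ ^ (3 + α)) ∧
    fracLapConst 3 α * ∫ y : EuclideanSpace ℝ (Fin 3),
      (1 - ((1 + ‖y‖ ^ 2) ^ 2)⁻¹) / ‖y‖ ^ (3 + α) = Real.Gamma (3 + α) / 2 := by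
  obtain ⟨i, e⟩ := aux_r hα
  obtain ⟨h0, h2⟩ := hα
  constructor
  · refine (integrable_fun_norm_addHaar (E := EuclideanSpace ℝ (Fin 3)) volume
      (f := fun r : ℝ => (1 - ((1 + r ^ 2) ^ 2)⁻¹) / r ^ (3 + α))).2 ?_
    simpa using i
  · have hI := integral_fun_norm_addHaar (E := EuclideanSpace ℝ (Fin 3)) volume
      (fun r : ℝ => (1 - ((1 + r ^ 2) ^ 2)⁻¹) / r ^ (3 + α))
    have hb : (volume : Measure (EuclideanSpace ℝ (Fin 3))).real (Metric.ball 0 1) =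
        Real.pi * 4 / 3 := by
      rw [Measure.real, EuclideanSpace.volume_ball_fin_three]
      simp only [ENNReal.ofReal_one, one_pow, one_mul]
      exact ENNReal.toReal_ofReal (by positivity)
    rw [hb, finrank_euclideanSpace_fin, show 3 - 1 = 2 from rfl, e] at hI
    rw [hI]
    have hg := Real.Gamma_mul_Gamma_add_half ((α + 3) / 2)
    rw [show (α + 3) / 2 + 1 / 2 = α / 2 + 2 by ring, show 2 * ((α + 3) / 2) = 3 + α by ring,
      show 1 - (3 + α) = -(α - 1) + (-3) by ring, Real.rpow_add two_pos,
      Real.rpow_neg two_pos.le (α - 1)] at hg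
    have h3 : (2:ℝ) ^ (-3 : ℝ) = 1 / 8 := by
      rw [Real.rpow_neg two_pos.le]; norm_num
    have hpi : Real.pi ^ ((3:ℝ) / 2) = Real.pi * √Real.pi := by
      rw [show (3:ℝ) / 2 = 1 + 1 / 2 by norm_num, Real.rpow_add Real.pi_pos, Real.rpow_one,
        Real.sqrt_eq_rpow]
    rw [h3] at hg
    have hG : Real.Gamma (1 - α / 2) ≠ 0 := (Real.Gamma_pos_of_pos (by linarith)).ne'
    have hp : (0:ℝ) < 2 ^ (α - 1) := by positivity
    have hs : 0 < √Real.pi := Real.sqrt_pos.2 Real.pi_pos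
    have hπ := Real.pi_pos
    unfold fracLapConst
    simp only [Nat.cast_ofNat, nsmul_eq_mul, smul_eq_mul]
    rw [hpi]
    calc _ = 4 * 2 ^ (α - 1) * (Real.Gamma ((α + 3) / 2) * Real.Gamma (α / 2 + 2)) / √Real.pi := by
          field_simp
      _ = _ := by
          rw [hg]
          field_simp
          norm_num
end

section
/- Strict positive definiteness of generalized inverse multiquadric functions: let d ≥ 1 be an integer, β < 0 a real number, and ε > 0. Then for every finite collection of pairwise distinct points x₁, …, x_N ∈ ℝ^d (N ≥ 1) and every vector c = (c₁, …, c_N) ∈ ℝ^N with c ≠ 0, one has Σ_{i=1}^{N} Σ_{j=1}^{N} c_i c_j (1 + ε² |x_i − x_j|²)^{β} > 0. -/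
open MeasureTheory Real

/-- The Gaussian is the cosine transform of the standard Gaussian measure. -/
lemma gimq_gauss_cos {d : ℕ} (y : EuclideanSpace ℝ (Fin d)) :
    ∫ u, Real.cos (inner ℝ u y) ∂(ProbabilityTheory.stdGaussian (EuclideanSpace ℝ (Fin d)))
      = Real.exp (-‖y‖ ^ 2 / 2) := by
  have h := ProbabilityTheory.charFun_stdGaussian y
  rw [charFun_apply] at h
  have hint : Integrable (fun u : EuclideanSpace ℝ (Fin d) =>
      Complex.exp (((inner ℝ u y : ℝ) : ℂ) * Complex.I))
      (ProbabilityTheory.stdGaussian (EuclideanSpace ℝ (Fin d))) := by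
    refine Integrable.of_bound (C := 1) (Continuous.aestronglyMeasurable (by fun_prop)) ?_
    exact Filter.Eventually.of_forall fun u => by rw [Complex.norm_exp_ofReal_mul_I]
  have h2 := congrArg Complex.re h
  have h3 := integral_re hint
  simp only [RCLike.re_to_complex, Complex.exp_ofReal_mul_I_re] at h3
  rw [h3, h2]
  norm_cast

/-- Gaussian kernels are positive semidefinite. -/
lemma gimq_gauss_nonneg {d N : ℕ} (y : Fin N → EuclideanSpace ℝ (Fin d)) (c : Fin N → ℝ) :
    0 ≤ ∑ i, ∑ j, c i * c j * Real.exp (-‖y i - y j‖ ^ 2 / 2) := by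
  simp_rw [← gimq_gauss_cos]
  have hint : ∀ i j, Integrable (fun u : EuclideanSpace ℝ (Fin d) =>
      c i * c j * Real.cos (inner ℝ u (y i - y j)))
      (ProbabilityTheory.stdGaussian (EuclideanSpace ℝ (Fin d))) := by
    intro i j
    refine Integrable.const_mul ?_ _
    refine Integrable.of_bound (C := 1) (Continuous.aestronglyMeasurable (by fun_prop)) ?_
    exact Filter.Eventually.of_forall fun u => Real.abs_cos_le_one _
  simp_rw [← integral_const_mul]
  simp_rw [← integral_finsetSum _ (fun j _ => hint _ j)]
  rw [← integral_finsetSum _ (fun i _ => integrable_finsetSum _ (fun j _ => hint i j))]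
  refine integral_nonneg fun u => ?_
  have : ∑ i, ∑ j, c i * c j * Real.cos (inner ℝ u (y i - y j))
      = (∑ i, c i * Real.cos (inner ℝ u (y i))) ^ 2
        + (∑ i, c i * Real.sin (inner ℝ u (y i))) ^ 2 := by
    rw [sq, sq, Finset.sum_mul_sum, Finset.sum_mul_sum, ← Finset.sum_add_distrib]
    refine Finset.sum_congr rfl fun i _ => ?_
    rw [← Finset.sum_add_distrib]
    refine Finset.sum_congr rfl fun j _ => ?_
    rw [inner_sub_right, Real.cos_sub]
    ring
  simp only [Pi.zero_apply]
  rw [this]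
  positivity

/-- Strict positive definiteness of generalized inverse multiquadric functions:
for `d ≥ 1`, `β < 0`, `ε > 0`, pairwise distinct `x₁, …, x_N ∈ ℝ^d` (`N ≥ 1`) and nonzero
`c ∈ ℝ^N`, one has `Σᵢ Σⱼ cᵢ cⱼ (1 + ε²|xᵢ - xⱼ|²)^β > 0`. -/
theorem GIMQ_strictly_positive_definite (d : ℕ) (hd : 1 ≤ d) (β : ℝ) (hβ : β < 0)
    (ε : ℝ) (hε : 0 < ε) (N : ℕ) (hN : 1 ≤ N)
    (x : Fin N → EuclideanSpace ℝ (Fin d)) (hx : Function.Injective x)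
    (c : Fin N → ℝ) (hc : c ≠ 0) :
    0 < ∑ i : Fin N, ∑ j : Fin N,
      c i * c j * (1 + ε ^ 2 * ‖x i - x j‖ ^ 2) ^ β := by
  set r : Fin N → Fin N → ℝ := fun i j => 1 + ε ^ 2 * ‖x i - x j‖ ^ 2 with hr
  have hr0 : ∀ i j, 0 < r i j := fun i j => by simp only [hr]; positivity
  have hΓ : 0 < Real.Gamma (-β) := Real.Gamma_pos_of_pos (by linarith)
  have hI : ∀ i j, ∫ t : ℝ in Set.Ioi 0, t ^ (-β - 1) * Real.exp (-(r i j * t))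
      = (r i j) ^ β * Real.Gamma (-β) := by
    intro i j
    rw [Real.integral_rpow_mul_exp_neg_mul_Ioi (by linarith) (hr0 i j), one_div,
      Real.inv_rpow (hr0 i j).le, Real.rpow_neg (hr0 i j).le, inv_inv]
  have hint : ∀ i j, IntegrableOn (fun t : ℝ =>
      c i * c j * (t ^ (-β - 1) * Real.exp (-(r i j * t)))) (Set.Ioi 0) := by
    intro i j
    refine Integrable.const_mul ?_ _
    have := integrableOn_rpow_mul_exp_neg_mul_rpow (p := 1) (s := -β - 1) (b := r i j)
      (by linarith) one_pos (hr0 i j)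
    simpa [IntegrableOn] using this
  suffices h : 0 < (∑ i, ∑ j, c i * c j * (r i j) ^ β) * Real.Gamma (-β) from
    pos_of_mul_pos_left h hΓ.le
  -- the Gaussian quadratic form
  set Q : ℝ → ℝ := fun t => ∑ i, ∑ j, c i * c j * Real.exp (-(ε ^ 2 * ‖x i - x j‖ ^ 2) * t)
    with hQ
  have hfac : ∀ t : ℝ, ∑ i, ∑ j, c i * c j * (t ^ (-β - 1) * Real.exp (-(r i j * t)))
      = t ^ (-β - 1) * Real.exp (-t) * Q t := by
    intro t
    simp only [hQ, Finset.mul_sum]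
    refine Finset.sum_congr rfl fun i _ => Finset.sum_congr rfl fun j _ => ?_
    have : -(r i j * t) = -t + -(ε ^ 2 * ‖x i - x j‖ ^ 2) * t := by simp only [hr]; ring
    rw [this, Real.exp_add]
    ring
  have hint' : IntegrableOn (fun t : ℝ => t ^ (-β - 1) * Real.exp (-t) * Q t) (Set.Ioi 0) := by
    simp_rw [← hfac]
    exact integrable_finsetSum _ fun i _ => integrable_finsetSum _ fun j _ => hint i j
  have heq : (∑ i, ∑ j, c i * c j * (r i j) ^ β) * Real.Gamma (-β)
      = ∫ t : ℝ in Set.Ioi 0, t ^ (-β - 1) * Real.exp (-t) * Q t := by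
    simp_rw [← hfac]
    rw [integral_finsetSum _ (fun i _ => integrable_finsetSum _ (fun j _ => hint i j)),
      Finset.sum_mul]
    refine Finset.sum_congr rfl fun i _ => ?_
    rw [integral_finsetSum _ (fun j _ => hint i j), Finset.sum_mul]
    refine Finset.sum_congr rfl fun j _ => ?_
    rw [integral_const_mul, hI, mul_assoc]
  have hQ0 : ∀ t : ℝ, 0 < t → 0 ≤ Q t := by
    intro t ht
    have h := gimq_gauss_nonneg (fun i => (ε * √(2 * t)) • x i) c
    simp only [← smul_sub, norm_smul, mul_pow] at h
    convert h using 7 with i _ j _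
    rw [Real.norm_eq_abs, sq_abs, mul_pow, Real.sq_sqrt (by positivity)]
    ring
  have hlim : Filter.Tendsto Q Filter.atTop (nhds (∑ i, c i ^ 2)) := by
    refine tendsto_finsetSum _ fun i _ => ?_
    have h1 : c i ^ 2 = ∑ j, if i = j then c i ^ 2 else 0 := by simp
    rw [h1]
    refine tendsto_finsetSum _ fun j _ => ?_
    split_ifs with hij
    · subst hij
      simp [sq]
    · have hpos : 0 < ε ^ 2 * ‖x i - x j‖ ^ 2 := by
        have : 0 < ‖x i - x j‖ := norm_pos_iff.2 (sub_ne_zero.2 fun h => hij (hx h))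
        positivity
      have h2 : Filter.Tendsto (fun t : ℝ => -(ε ^ 2 * ‖x i - x j‖ ^ 2) * t)
          Filter.atTop Filter.atBot :=
        Filter.tendsto_id.const_mul_atTop_of_neg (by linarith)
      simpa using (Real.tendsto_exp_atBot.comp h2).const_mul (c i * c j)
  have hcpos : 0 < ∑ i, c i ^ 2 := by
    obtain ⟨k, hk⟩ := Function.ne_iff.1 hc
    exact Finset.sum_pos' (fun i _ => sq_nonneg _) ⟨k, Finset.mem_univ _, sq_pos_of_ne_zero hk⟩
  obtain ⟨T, hT⟩ := Filter.eventually_atTop.1 (hlim.eventually (lt_mem_nhds hcpos))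
  rw [heq, setIntegral_pos_iff_support_of_nonneg_ae _ hint']
  · have hsub : Set.Ioi (max T 0) ⊆ Function.support
        (fun t : ℝ => t ^ (-β - 1) * Real.exp (-t) * Q t) ∩ Set.Ioi 0 := by
      intro t ht
      have ht1 : T < t := lt_of_le_of_lt (le_max_left _ _) ht
      have ht0 : 0 < t := lt_of_le_of_lt (le_max_right _ _) ht
      have := hT t ht1.le
      refine ⟨ne_of_gt ?_, ht0⟩
      positivity
    refine lt_of_lt_of_le ?_ (measure_mono hsub)
    simp
  · refine Filter.eventually_of_mem (self_mem_ae_restrict measurableSet_Ioi) fun t ht => ?_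
    have ht0 : (0 : ℝ) < t := ht
    have := hQ0 t ht0
    simp only [Pi.zero_apply]
    positivity
end

section
/- Invertibility of the GIMQ interpolation matrix: let d ≥ 1 be an integer, ε > 0, and let x₁, …, x_N ∈ ℝ^d (N ≥ 1) be pairwise distinct. Then the N × N matrix Φ with entries Φ_{ij} = (1 + ε² |x_i − x_j|²)^{-(d+1)/2} is symmetric positive definite; in particular Φ is invertible. -/
open MeasureTheory Real Matrix

/-- The character `z ↦ exp (s ⟪a, z⟫)`. -/
noncomputable def gimqChar {E : Type*} [NormedAddCommGroup E] [InnerProductSpace ℝ E]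
    (s : ℝ) (a : E) : Multiplicative E →* ℝ where
  toFun z := Real.exp (s * inner ℝ a z.toAdd)
  map_one' := by simp
  map_mul' u v := by
    simp [inner_add_right, mul_add, Real.exp_add]

theorem gimqChar_injective {E : Type*} [NormedAddCommGroup E] [InnerProductSpace ℝ E]
    {s : ℝ} (hs : s ≠ 0) : Function.Injective (gimqChar (E := E) s) := by
  intro a b hab
  have h := DFunLike.congr_fun hab (Multiplicative.ofAdd (a - b))
  have h2 : Real.exp (s * inner ℝ a (a - b)) = Real.exp (s * inner ℝ b (a - b)) := h
  have h3 := mul_left_cancel₀ hs (Real.exp_injective h2)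
  have h4 : inner ℝ (a - b) (a - b) = (0 : ℝ) := by
    rw [inner_sub_left, h3, sub_self]
  exact sub_eq_zero.1 (inner_self_eq_zero.1 h4)

/-- Shifted Gaussians are linearly independent. -/
theorem gimq_gauss_indep {E : Type*} [NormedAddCommGroup E] [InnerProductSpace ℝ E]
    {N : ℕ} (x : Fin N → E) (hx : Function.Injective x) {s : ℝ} (hs : 0 < s)
    (c : Fin N → ℝ) (hc : c ≠ 0) :
    ∃ z : E, ∑ i, c i * Real.exp (-(2 * s) * ‖x i - z‖ ^ 2) ≠ 0 := by
  by_contra hcon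
  push Not at hcon
  have hinj : Function.Injective (fun i => gimqChar (4 * s) (x i)) :=
    (gimqChar_injective (by positivity)).comp hx
  have hli := (linearIndependent_monoidHom (Multiplicative E) ℝ).comp _ hinj
  rw [Fintype.linearIndependent_iff] at hli
  have hzero := hli (fun i => c i * Real.exp (-(2 * s) * ‖x i‖ ^ 2)) (by
    funext z
    have hz := hcon z.toAdd
    simp only [Finset.sum_apply, Pi.smul_apply, Function.comp, smul_eq_mul, Pi.zero_apply]
    have h1 : ∀ i, c i * Real.exp (-(2 * s) * ‖x i - z.toAdd‖ ^ 2)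
        = Real.exp (-(2 * s) * ‖z.toAdd‖ ^ 2) *
          (c i * Real.exp (-(2 * s) * ‖x i‖ ^ 2) * gimqChar (4 * s) (x i) z) := by
      intro i
      change _ = Real.exp (-(2 * s) * ‖z.toAdd‖ ^ 2) *
          (c i * Real.exp (-(2 * s) * ‖x i‖ ^ 2) * Real.exp (4 * s * inner ℝ (x i) z.toAdd))
      rw [mul_assoc (c i), mul_left_comm, ← Real.exp_add, ← Real.exp_add,
        norm_sub_sq_real]
      congr 2
      ring
    simp_rw [h1] at hz
    rw [← Finset.mul_sum] at hz
    exact (mul_eq_zero.1 hz).resolve_left (Real.exp_pos _).ne')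
  apply hc
  funext i
  exact (mul_eq_zero.1 (hzero i)).resolve_right (Real.exp_pos _).ne'

theorem gimq_gauss_mul {E : Type*} [NormedAddCommGroup E] [InnerProductSpace ℝ E]
    (s : ℝ) (a b z : E) :
    Real.exp (-(2 * s) * ‖a - z‖ ^ 2) * Real.exp (-(2 * s) * ‖b - z‖ ^ 2)
      = Real.exp (-s * ‖a - b‖ ^ 2) *
        Real.exp (-(4 * s) * ‖z - (1 / 2 : ℝ) • (a + b)‖ ^ 2) := by
  rw [← Real.exp_add, ← Real.exp_add]
  congr 1
  simp only [norm_sub_sq_real, norm_smul, mul_pow, norm_add_sq_real, inner_smul_right,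
    inner_add_right, real_inner_comm z, Real.norm_eq_abs, sq_abs]
  ring

/-- The Gaussian kernel is strictly positive definite. -/
theorem gimq_gauss_pos {d N : ℕ} (x : Fin N → EuclideanSpace ℝ (Fin d))
    (hx : Function.Injective x) {s : ℝ} (hs : 0 < s) (c : Fin N → ℝ) (hc : c ≠ 0) :
    0 < ∑ i, ∑ j, c i * c j * Real.exp (-s * ‖x i - x j‖ ^ 2) := by
  obtain ⟨z, hz⟩ := gimq_gauss_indep x hx hs c hc
  set C : ℝ := ∫ v : EuclideanSpace ℝ (Fin d), Real.exp (-(4 * s) * ‖v‖ ^ 2) with hC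
  have hCpos : 0 < C := by
    rw [hC, GaussianFourier.integral_rexp_neg_mul_sq_norm (by positivity)]
    positivity
  have hCint : Integrable fun v : EuclideanSpace ℝ (Fin d) => Real.exp (-(4 * s) * ‖v‖ ^ 2) :=
    .of_integral_ne_zero hCpos.ne'
  have hsq : ∀ z, (∑ i, c i * Real.exp (-(2 * s) * ‖x i - z‖ ^ 2)) ^ 2
      = ∑ i, ∑ j, c i * c j * Real.exp (-s * ‖x i - x j‖ ^ 2) *
        Real.exp (-(4 * s) * ‖z - (1 / 2 : ℝ) • (x i + x j)‖ ^ 2) := by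
    intro z
    rw [sq, Finset.sum_mul_sum]
    refine Finset.sum_congr rfl fun i _ => Finset.sum_congr rfl fun j _ => ?_
    rw [mul_mul_mul_comm, gimq_gauss_mul, mul_assoc (c i * c j)]
  have hint : ∀ i j, Integrable fun z => c i * c j * Real.exp (-s * ‖x i - x j‖ ^ 2) *
        Real.exp (-(4 * s) * ‖z - (1 / 2 : ℝ) • (x i + x j)‖ ^ 2) := fun i j =>
    (hCint.comp_sub_right ((1 / 2 : ℝ) • (x i + x j))).const_mul _
  have hpos : 0 < ∫ z, (∑ i, c i * Real.exp (-(2 * s) * ‖x i - z‖ ^ 2)) ^ 2 := by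
    refine integral_pos_of_integrable_nonneg_nonzero (x := z) (by fun_prop) ?_
      (fun z => sq_nonneg _) (pow_ne_zero 2 hz)
    simp_rw [hsq]
    exact integrable_finsetSum _ fun i _ => integrable_finsetSum _ fun j _ => hint i j
  have heq : ∫ z, (∑ i, c i * Real.exp (-(2 * s) * ‖x i - z‖ ^ 2)) ^ 2
      = (∑ i, ∑ j, c i * c j * Real.exp (-s * ‖x i - x j‖ ^ 2)) * C := by
    simp_rw [hsq]
    rw [integral_finsetSum _ fun i _ => integrable_finsetSum _ fun j _ => hint i j,
      Finset.sum_mul]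
    refine Finset.sum_congr rfl fun i _ => ?_
    rw [integral_finsetSum _ fun j _ => hint i j, Finset.sum_mul]
    refine Finset.sum_congr rfl fun j _ => ?_
    rw [integral_const_mul,
      integral_sub_right_eq_self (fun v : EuclideanSpace ℝ (Fin d) =>
        Real.exp (-(4 * s) * ‖v‖ ^ 2))]
  rw [heq] at hpos
  exact pos_of_mul_pos_left hpos hCpos.le

theorem gimq_quad_pos {d N : ℕ} (x : Fin N → EuclideanSpace ℝ (Fin d))
    (hx : Function.Injective x) {ε a : ℝ} (hε : 0 < ε) (ha : 0 < a)
    (c : Fin N → ℝ) (hc : c ≠ 0) :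
    0 < ∑ i, ∑ j, c i * c j * (1 + ε ^ 2 * ‖x i - x j‖ ^ 2) ^ (-a) := by
  have hG := Real.Gamma_pos_of_pos ha
  have hr : ∀ i j, 0 < 1 + ε ^ 2 * ‖x i - x j‖ ^ 2 := fun i j => by positivity
  have hI : ∀ i j, ∫ t in Set.Ioi (0 : ℝ), t ^ (a - 1) *
      Real.exp (-((1 + ε ^ 2 * ‖x i - x j‖ ^ 2) * t))
      = (1 + ε ^ 2 * ‖x i - x j‖ ^ 2) ^ (-a) * Real.Gamma a := by
    intro i j
    rw [Real.integral_rpow_mul_exp_neg_mul_Ioi ha (hr i j), one_div,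
      Real.inv_rpow (hr i j).le, Real.rpow_neg (hr i j).le]
  have hint : ∀ i j, IntegrableOn (fun t => c i * c j * (t ^ (a - 1) *
      Real.exp (-((1 + ε ^ 2 * ‖x i - x j‖ ^ 2) * t)))) (Set.Ioi (0 : ℝ)) := by
    intro i j
    refine Integrable.const_mul (.of_integral_ne_zero ?_) _
    rw [hI]
    have := hr i j
    positivity
  have hint2 := integrable_finsetSum Finset.univ fun i _ =>
    integrable_finsetSum Finset.univ fun j _ => hint i j
  have hptw : ∀ t ∈ Set.Ioi (0 : ℝ), 0 < ∑ i, ∑ j, c i * c j * (t ^ (a - 1) *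
      Real.exp (-((1 + ε ^ 2 * ‖x i - x j‖ ^ 2) * t))) := by
    intro t ht
    have ht0 : 0 < t := ht
    have h := gimq_gauss_pos x hx (s := t * ε ^ 2) (by positivity) c hc
    have h2 : ∑ i, ∑ j, c i * c j * (t ^ (a - 1) *
        Real.exp (-((1 + ε ^ 2 * ‖x i - x j‖ ^ 2) * t)))
        = t ^ (a - 1) * Real.exp (-t) *
          ∑ i, ∑ j, c i * c j * Real.exp (-(t * ε ^ 2) * ‖x i - x j‖ ^ 2) := by
      simp_rw [Finset.mul_sum]
      refine Finset.sum_congr rfl fun i _ => Finset.sum_congr rfl fun j _ => ?_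
      have h3 : Real.exp (-((1 + ε ^ 2 * ‖x i - x j‖ ^ 2) * t))
          = Real.exp (-t) * Real.exp (-(t * ε ^ 2) * ‖x i - x j‖ ^ 2) := by
        rw [← Real.exp_add]
        congr 1
        ring
      rw [h3]
      ring
    rw [h2]
    positivity
  have hpos : 0 < ∫ t in Set.Ioi (0 : ℝ), ∑ i, ∑ j, c i * c j * (t ^ (a - 1) *
      Real.exp (-((1 + ε ^ 2 * ‖x i - x j‖ ^ 2) * t))) := by
    rw [setIntegral_pos_iff_support_of_nonneg_ae
      ((ae_restrict_mem measurableSet_Ioi).mono fun t ht => (hptw t ht).le) hint2]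
    refine lt_of_lt_of_le ?_ (measure_mono (s := Set.Ioi (0 : ℝ)) fun t ht =>
      ⟨(hptw t ht).ne', ht⟩)
    simp
  have heq : ∫ t in Set.Ioi (0 : ℝ), ∑ i, ∑ j, c i * c j * (t ^ (a - 1) *
      Real.exp (-((1 + ε ^ 2 * ‖x i - x j‖ ^ 2) * t)))
      = (∑ i, ∑ j, c i * c j * (1 + ε ^ 2 * ‖x i - x j‖ ^ 2) ^ (-a)) * Real.Gamma a := by
    rw [integral_finsetSum _ fun i _ => integrable_finsetSum _ fun j _ => hint i j,
      Finset.sum_mul]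
    refine Finset.sum_congr rfl fun i _ => ?_
    rw [integral_finsetSum _ fun j _ => hint i j, Finset.sum_mul]
    refine Finset.sum_congr rfl fun j _ => ?_
    rw [integral_const_mul, hI, mul_assoc (c i * c j)]
  rw [heq] at hpos
  exact pos_of_mul_pos_left hpos hG.le

/-- Invertibility of the GIMQ interpolation matrix: for `d ≥ 1`, `ε > 0` and
pairwise distinct `x₁, …, x_N ∈ ℝ^d` (`N ≥ 1`), the `N × N` matrix
`Φᵢⱼ = (1 + ε²|xᵢ - xⱼ|²)^{-(d+1)/2}` is symmetric positive definite; in particular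
it is invertible. -/
theorem GIMQ_interpolation_matrix_posDef (d : ℕ) (hd : 1 ≤ d) (ε : ℝ) (hε : 0 < ε)
    (N : ℕ) (hN : 1 ≤ N) (x : Fin N → EuclideanSpace ℝ (Fin d))
    (hx : Function.Injective x)
    (Φ : Matrix (Fin N) (Fin N) ℝ)
    (hΦ : ∀ i j, Φ i j = (1 + ε ^ 2 * ‖x i - x j‖ ^ 2) ^ (-((d : ℝ) + 1) / 2)) :
    Φ.IsSymm ∧ Φ.PosDef ∧ IsUnit Φ := by
  have hsymm : Φ.IsSymm := by
    ext i j
    rw [Matrix.transpose_apply, hΦ, hΦ, norm_sub_rev]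
  have hpd : Φ.PosDef := by
    refine Matrix.PosDef.of_dotProduct_mulVec_pos ?_ ?_
    · rw [Matrix.IsHermitian, Matrix.conjTranspose_eq_transpose_of_trivial]
      exact hsymm
    · intro c hc
      have h := gimq_quad_pos x hx hε (a := ((d : ℝ) + 1) / 2) (by positivity) c hc
      refine lt_of_lt_of_eq h (Eq.symm ?_)
      simp only [dotProduct, Matrix.mulVec, star_trivial, Finset.mul_sum]
      refine Finset.sum_congr rfl fun i _ => Finset.sum_congr rfl fun j _ => ?_
      rw [hΦ, neg_div]
      ring
  exact ⟨hsymm, hpd, hpd.isUnit⟩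
end
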